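/- arXiv:1705.02978 — 2 statements merged into one kernel-verified Lean document; each statement's English description precedes it below -/
import Mathlib

section
/- Let d ≥ 2, let K = {k_1, …, k_r} ⊂ {1, …, d−1} consist of r distinct elements ordered so that min{k_1, d−k_1} ≥ min{k_2, d−k_2} ≥ … ≥ min{k_r, d−k_r}, and let t ≥ 1. Then the null space of the restriction map |_{G_{k_1,d}} : Pol_t(G_{K,d}) → Pol_t(G_{k_1,d}), f ↦ f|_{G_{k_1,d}}, equals (Tr(·) − k_1) · Pol_{t−1}(G_{K,d}); that is, a function f ∈ Pol_t(G_{K,d}) vanishes identically on G_{k_1,d} if and only if f(P) = (tr(P) − k_1) g(P) for all P ∈ G_{K,d}, for some g ∈ Pol_{t−1}(G_{K,d}). -/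
open Matrix MvPolynomial

/-- The Grassmannian `G_{k,d}` of rank-`k` orthogonal projectors in `ℝ^{d×d}`. -/
def Grass (d k : ℕ) : Set (Matrix (Fin d) (Fin d) ℝ) :=
  {P | P.IsSymm ∧ P * P = P ∧ P.trace = k}

/-- Evaluation of a polynomial in the entries of a symmetric `d×d` matrix as a function on a
set `S` of matrices, as a linear map. -/
noncomputable def evalOn {d : ℕ} (S : Set (Matrix (Fin d) (Fin d) ℝ)) :
    MvPolynomial (Fin d × Fin d) ℝ →ₗ[ℝ] (S → ℝ) where
  toFun p := fun P => MvPolynomial.eval (fun ij => (P : Matrix (Fin d) (Fin d) ℝ) ij.1 ij.2) p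
  map_add' p q := by funext P; simp
  map_smul' c p := by funext P; simp [MvPolynomial.smul_eval]

/-- `Pol_t(S)`: the space of restrictions to `S` of real polynomials of degree at most `t` in
the entries of a `d×d` matrix, as a subspace of the functions `S → ℝ`. -/
noncomputable def PolOn {d : ℕ} (t : ℕ) (S : Set (Matrix (Fin d) (Fin d) ℝ)) :
    Submodule ℝ (S → ℝ) :=
  Submodule.map (evalOn S) (MvPolynomial.restrictTotalDegree (Fin d × Fin d) ℝ t)


open MeasureTheory in
theorem haar_lemma {G : Type*} [Group G] [TopologicalSpace G] [IsTopologicalGroup G]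
    [CompactSpace G] (U : Submodule ℝ (G → ℝ)) [FiniteDimensional ℝ U]
    (hc : ∀ u ∈ U, Continuous u) (hl : ∀ u ∈ U, ∀ g : G, (fun x => u (g * x)) ∈ U) :
    ∃ h ∈ U, (∀ k : G, (∀ u ∈ U, u k⁻¹ = u 1) → ∀ x, h (k * x) = h x) ∧
      ∀ U' : Submodule ℝ (G → ℝ), (∀ u ∈ U', ∀ g : G, (fun x => u (g * x)) ∈ U') →
        h ∈ U' → U ≤ U' := by
  let _ : MeasurableSpace G := borel G
  have _ : BorelSpace G := ⟨rfl⟩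
  let μ : Measure G := Measure.haar
  have hintg : ∀ u : G → ℝ, Continuous u → Integrable u μ := fun u hu =>
    hu.integrable_of_hasCompactSupport (HasCompactSupport.of_compactSpace u)
  have hintg2 : ∀ u v : U, Integrable (fun x => u.1 x * v.1 x) μ := fun u v =>
    hintg _ ((hc _ u.2).mul (hc _ v.2))
  let B : U →ₗ[ℝ] U →ₗ[ℝ] ℝ := LinearMap.mk₂ ℝ (fun u v => ∫ x, u.1 x * v.1 x ∂μ)
    (by
      intro u u' v
      rw [← integral_add (hintg2 u v) (hintg2 u' v)]
      congr 1; ext x; simp [add_mul])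
    (by
      intro c u v
      rw [smul_eq_mul, ← integral_const_mul]
      congr 1; ext x; simp [mul_assoc])
    (by
      intro u v v'
      rw [← integral_add (hintg2 u v) (hintg2 u v')]
      congr 1; ext x; simp [mul_add])
    (by
      intro c u v
      rw [smul_eq_mul, ← integral_const_mul]
      congr 1; ext x; simp [mul_left_comm])
  have hB : ∀ u v : U, B u v = ∫ x, u.1 x * v.1 x ∂μ := fun u v => rfl
  have hsymm : ∀ u v : U, B u v = B v u := by
    intro u v; rw [hB, hB]; congr 1; ext x; ring
  have hpos : ∀ u : U, B u u = 0 → u = 0 := by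
    intro u hu
    rw [hB] at hu
    ext x
    by_contra hx
    have := ((hc _ u.2).mul (hc _ u.2)).integral_pos_of_hasCompactSupport_nonneg_nonzero (μ := μ)
      (HasCompactSupport.of_compactSpace _) (fun x => mul_self_nonneg _) (x := x)
      (by simpa using hx)
    simp at this hu
    linarith
  have hinj : Function.Injective B := by
    rw [← LinearMap.ker_eq_bot, LinearMap.ker_eq_bot']
    intro u hu
    exact hpos u (by rw [hu]; rfl)
  have hsurj : Function.Surjective B :=
    (LinearMap.injective_iff_surjective_of_finrank_eq_finrank
      (Subspace.dual_finrank_eq (K := ℝ) (V := U)).symm).1 hinj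
  let tr : G → U → U := fun g u => ⟨fun x => u.1 (g * x), hl u.1 u.2 g⟩
  have htr : ∀ g u v, B (tr g u) v = B u (tr g⁻¹ v) := by
    intro g u v
    rw [hB, hB]
    have := integral_mul_left_eq_self (μ := μ) (fun x => u.1 x * v.1 (g⁻¹ * x)) g
    rw [← this]
    congr 1; ext x; simp [tr]
  let ev : U →ₗ[ℝ] ℝ := (LinearMap.proj (1 : G)).comp U.subtype
  obtain ⟨h, hh⟩ := hsurj ev
  have hh' : ∀ u : U, B h u = u.1 1 := fun u => by rw [hh]; rfl
  refine ⟨h.1, h.2, ?_, ?_⟩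
  · intro k hk
    have : tr k h = h := by
      apply hinj
      ext u
      rw [htr, hh', hh']
      simpa [tr] using hk u.1 u.2
    intro x
    exact congrFun (congrArg Subtype.val this) x
  · intro U' hU' hhU' f hf
    by_contra hfU
    let T : Submodule ℝ U := U'.comap U.subtype
    have hfT : (⟨f, hf⟩ : U) ∉ T := hfU
    obtain ⟨φ, hφ1, hφ2⟩ := Submodule.exists_le_ker_of_notMem hfT
    obtain ⟨u, hu⟩ := hsurj φ
    have hu0 : u = 0 := by
      ext g
      have h1 : tr g⁻¹ h ∈ T := hU' _ hhU' _
      have h2 := hφ2 h1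
      rw [LinearMap.mem_ker, ← hu, hsymm, htr, hh'] at h2
      simpa [tr] using h2
    apply hφ1
    rw [← hu, hu0]; simp


theorem inj_sum_mem {Y : Type*} {N : ℕ} (y : Y → Fin N → ℝ) (A : ℕ → Submodule ℝ (Y → ℝ))
    (h1 : (1 : Y → ℝ) ∈ A 0)
    (hmul : ∀ s t f g, f ∈ A s → g ∈ A t → f * g ∈ A (s + t))
    (hp : ∀ b : ℕ, (fun x => ∑ a, y x a ^ b) ∈ A b) (n : ℕ) :
    ∀ β : Fin n → ℕ, (fun x => ∑ φ : Fin n ↪ Fin N, ∏ c, y x (φ c) ^ β c) ∈ A (∑ c, β c) := by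
  induction n with
  | zero =>
    intro β
    have : (fun x => ∑ φ : Fin 0 ↪ Fin N, ∏ c, y x (φ c) ^ β c) = 1 := by
      ext x; simp
    rw [this]; simpa using h1
  | succ n ih =>
    intro β
    have key : (fun x => ∑ φ : Fin (n+1) ↪ Fin N, ∏ c, y x (φ c) ^ β c) =
        (fun x => ∑ a, y x a ^ β 0) *
          (fun x => ∑ φ : Fin n ↪ Fin N, ∏ c, y x (φ c) ^ β (Fin.succ c)) -
        ∑ c : Fin n, (fun x => ∑ φ : Fin n ↪ Fin N, ∏ c', y x (φ c') ^
          (Function.update (fun i => β (Fin.succ i)) c (β 0 + β (Fin.succ c)) c')) := by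
      ext x
      rw [← (Equiv.embeddingFinSucc n (Fin N)).symm.sum_comp, Fintype.sum_sigma]
      simp only [Pi.sub_apply, Pi.mul_apply, Finset.sum_apply]
      rw [Finset.sum_comm, Finset.mul_sum, ← Finset.sum_sub_distrib]
      refine Finset.sum_congr rfl fun e _ => ?_
      have h2 : ∀ c : Fin n, ∏ c', y x (e c') ^
          (Function.update (fun i => β (Fin.succ i)) c (β 0 + β (Fin.succ c)) c') =
          y x (e c) ^ β 0 * ∏ c', y x (e c') ^ β (Fin.succ c') := by
        intro c
        rw [← Finset.mul_prod_erase _ _ (Finset.mem_univ c),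
          ← Finset.mul_prod_erase (f := fun c' => y x (e c') ^ β (Fin.succ c')) _
            (Finset.mem_univ c), ← mul_assoc, ← pow_add]
        simp only [Function.update_self]
        congr 1
        refine Finset.prod_congr rfl fun c' hc' => ?_
        rw [Function.update_of_ne (Finset.ne_of_mem_erase hc')]
      simp only [h2, ← Finset.sum_mul, ← sub_mul]
      have h3 : ∀ i : {i // i ∉ Set.range e},
          ∏ c, y x ((Equiv.embeddingFinSucc n (Fin N)).symm ⟨e, i⟩ c) ^ β c =
          y x i ^ β 0 * ∏ c', y x (e c') ^ β (Fin.succ c') := by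
        intro i
        rw [Fin.prod_univ_succ]
        simp [Equiv.coe_embeddingFinSucc_symm]
      simp only [h3, ← Finset.sum_mul]
      congr 1
      rw [eq_sub_iff_add_eq]
      have h4 : ∑ c, y x (e c) ^ β 0 = ∑ i : {i // i ∈ Set.range e}, y x i ^ β 0 := by
        rw [← (Equiv.ofInjective e e.injective).sum_comp]
        rfl
      rw [h4, add_comm]
      convert Fintype.sum_subtype_add_sum_subtype (fun i => i ∈ Set.range e) (fun i => y x i ^ β 0)
    rw [key]
    refine Submodule.sub_mem _ ?_ (Submodule.sum_mem _ fun c _ => ?_)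
    · rw [Fin.sum_univ_succ]
      exact hmul _ _ _ _ (hp _) (ih _)
    · have := ih (Function.update (fun i => β (Fin.succ i)) c (β 0 + β (Fin.succ c)))
      convert this using 1
      rw [Fin.sum_univ_succ, ← Finset.add_sum_erase _ _ (Finset.mem_univ c),
        ← Finset.add_sum_erase (a := c) (f := fun c' => Function.update (fun i => β (Fin.succ i)) c
          (β 0 + β (Fin.succ c)) c') _ (Finset.mem_univ c), ← add_assoc]
      simp only [Function.update_self]
      congr 2
      refine Finset.sum_congr rfl fun c' hc' => ?_
      rw [Function.update_of_ne (Finset.ne_of_mem_erase hc')]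

theorem perm_sum_mem {Y : Type*} {N : ℕ} (y : Y → Fin N → ℝ) (A : ℕ → Submodule ℝ (Y → ℝ))
    (h1 : (1 : Y → ℝ) ∈ A 0)
    (hmul : ∀ s t f g, f ∈ A s → g ∈ A t → f * g ∈ A (s + t))
    (hp : ∀ b : ℕ, (fun x => ∑ a, y x a ^ b) ∈ A b) (β : Fin N → ℕ) :
    (fun x => ∑ σ : Equiv.Perm (Fin N), ∏ c, y x (σ c) ^ β c) ∈ A (∑ c, β c) := by
  have := inj_sum_mem y A h1 hmul hp N β
  convert this using 2 with x
  rw [← (Equiv.embeddingEquivOfFinite (Fin N)).sum_comp]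
  rfl

theorem totalDegree_bind_le {σ τ : Type*} (f : σ → MvPolynomial τ ℝ)
    (hf : ∀ i, (f i).totalDegree ≤ 1) (p : MvPolynomial σ ℝ) :
    (bind₁ f p).totalDegree ≤ p.totalDegree := by
  conv_lhs => rw [p.as_sum, map_sum]
  refine totalDegree_finsetSum_le fun m hm => ?_
  rw [bind₁_monomial]
  refine (totalDegree_mul _ _).trans ?_
  rw [totalDegree_C, zero_add]
  refine (totalDegree_finsetProd _ _).trans ?_
  refine le_trans ?_ (le_totalDegree hm)
  refine Finset.sum_le_sum fun i _ => (totalDegree_pow _ _).trans ?_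
  nlinarith [hf i]

theorem eval_bind {σ τ : Type*} (f : σ → MvPolynomial τ ℝ) (x : τ → ℝ) (p : MvPolynomial σ ℝ) :
    eval x (bind₁ f p) = eval (fun i => eval x (f i)) p := by
  have := eval₂Hom_bind₁ (RingHom.id ℝ) x f p
  exact this

theorem peel_mon {κ : Type*} (t : ℕ) (c : ℝ) (m : κ ⊕ Unit →₀ ℕ) (a : ℝ)
    (hR : (m.sum fun _ e => e) ≤ t + 1) : ∃ R' : MvPolynomial (κ ⊕ Unit) ℝ, R'.totalDegree ≤ t ∧
      ∀ (y : κ → ℝ) (x : ℝ), eval (Sum.elim y fun _ => x) (monomial m a) =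
        eval (Sum.elim y fun _ => c) (monomial m a) + (x - c) * eval (Sum.elim y fun _ => x) R' := by
  classical
  set i := m (Sum.inr ()) with hi
  set m0 := m.erase (Sum.inr ()) with hm0
  have hm : m = m0 + Finsupp.single (Sum.inr ()) i := (Finsupp.erase_add_single _ m).symm
  have hdeg : (m0.sum fun _ e => e) + i ≤ t + 1 := by
    rw [hm, Finsupp.sum_add_index' (fun _ => rfl) (fun _ _ _ => rfl)] at hR
    simpa using hR
  have hmon : monomial m a = monomial m0 a * X (Sum.inr ()) ^ i := by
    rw [hm, monomial_add_single]
  have hev : ∀ (y : κ → ℝ) (x : ℝ), eval (Sum.elim y fun _ => x) (monomial m0 a) =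
      eval (Sum.elim y fun _ => c) (monomial m0 a) := by
    intro y x
    rw [eval_monomial, eval_monomial]
    congr 1
    refine Finsupp.prod_congr fun j hj => ?_
    rcases j with j | j
    · rfl
    · simp [hm0] at hj
  refine ⟨monomial m0 a * ∑ j ∈ Finset.range i, X (Sum.inr ()) ^ j * C c ^ (i - 1 - j), ?_, ?_⟩
  · rcases Nat.eq_zero_or_pos i with h0 | h0
    · simp [h0]
    refine (totalDegree_mul _ _).trans ?_
    have h1 := totalDegree_monomial_le (R := ℝ) m0 a
    have h2 : (∑ j ∈ Finset.range i, (X (Sum.inr ()) : MvPolynomial (κ ⊕ Unit) ℝ) ^ j *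
        C c ^ (i - 1 - j)).totalDegree ≤ i - 1 := by
      refine totalDegree_finsetSum_le fun j hj => ?_
      refine (totalDegree_mul _ _).trans ?_
      rw [← C_pow, totalDegree_C, totalDegree_X_pow]
      have := Finset.mem_range.1 hj
      omega
    simp only [Finsupp.sum, id] at *
    omega
  · intro y x
    rw [hmon]
    simp only [map_mul, map_pow, map_sum, eval_X, eval_C, Sum.elim_inr, hev y x]
    have := (Commute.all x c).geom_sum₂_mul i
    linear_combination (-(eval (Sum.elim y fun _ => c) (monomial m0 a))) * this

theorem peel_one {κ : Type*} (t : ℕ) (c : ℝ) (R : MvPolynomial (κ ⊕ Unit) ℝ)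
    (hR : R.totalDegree ≤ t + 1) : ∃ R' : MvPolynomial (κ ⊕ Unit) ℝ, R'.totalDegree ≤ t ∧
      ∀ (y : κ → ℝ) (x : ℝ), eval (Sum.elim y fun _ => x) R =
        eval (Sum.elim y fun _ => c) R + (x - c) * eval (Sum.elim y fun _ => x) R' := by
  have h : ∀ m ∈ R.support, ∃ R' : MvPolynomial (κ ⊕ Unit) ℝ, R'.totalDegree ≤ t ∧
      ∀ (y : κ → ℝ) (x : ℝ), eval (Sum.elim y fun _ => x) (monomial m (coeff m R)) =
        eval (Sum.elim y fun _ => c) (monomial m (coeff m R)) +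
          (x - c) * eval (Sum.elim y fun _ => x) R' :=
    fun m hm => peel_mon t c m _ ((le_totalDegree hm).trans hR)
  choose! f hf1 hf2 using h
  refine ⟨∑ m ∈ R.support, f m, totalDegree_finsetSum_le hf1, fun y x => ?_⟩
  conv_lhs => rw [R.as_sum, map_sum]
  conv_rhs => enter [1]; rw [R.as_sum, map_sum]
  rw [map_sum, Finset.mul_sum, ← Finset.sum_add_distrib]
  exact Finset.sum_congr rfl fun m hm => hf2 m hm y x

theorem peel_all {κ : Type*} (Y : Set (κ → ℝ)) (c0 : ℝ) (C : Finset ℝ) :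
    ∀ (t : ℕ) (R : MvPolynomial (κ ⊕ Unit) ℝ), R.totalDegree ≤ t → c0 ∉ C →
    (∀ y ∈ Y, ∀ c ∈ C, eval (Sum.elim y fun _ => c) R = 0) →
    ∃ q : MvPolynomial κ ℝ, (q = 0 ∨ q.totalDegree + C.card ≤ t) ∧
      ∀ y ∈ Y, eval (Sum.elim y fun _ => c0) R = eval y q := by
  classical
  induction C using Finset.induction_on with
  | empty =>
    intro t R hR _ _
    refine ⟨bind₁ (Sum.elim X fun _ => MvPolynomial.C c0) R, Or.inr ?_, ?_⟩
    · simp only [Finset.card_empty, add_zero]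
      refine (totalDegree_bind_le _ ?_ R).trans hR
      rintro (i | i) <;> simp
    · intro y _
      rw [eval_bind]
      congr 2
      ext (i | i) <;> simp
  | insert c C hc ih =>
    intro t R hR hc0 hv
    rw [Finset.mem_insert, not_or] at hc0
    rcases t with _ | t
    · refine ⟨0, Or.inl rfl, fun y hy => ?_⟩
      have h1 := hv y hy c (Finset.mem_insert_self _ _)
      rw [totalDegree_eq_zero_iff_eq_C.1 (Nat.le_zero.1 hR)] at h1 ⊢
      simpa using h1
    · obtain ⟨R', hR', h⟩ := peel_one t c R hR
      obtain ⟨q, hq, hq'⟩ := ih t R' hR' hc0.2 (by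
        intro y hy c' hc'
        have h1 := h y c'
        rw [hv y hy c' (Finset.mem_insert_of_mem hc'), hv y hy c (Finset.mem_insert_self _ _),
          zero_add] at h1
        have h2 : c' - c ≠ 0 := sub_ne_zero.2 (fun h => hc (h ▸ hc'))
        exact (mul_eq_zero.1 h1.symm).resolve_left h2)
      refine ⟨MvPolynomial.C (c0 - c) * q, ?_, ?_⟩
      · rcases hq with rfl | hq
        · left; simp
        · right
          rw [Finset.card_insert_of_notMem hc]
          have := totalDegree_mul (MvPolynomial.C (c0 - c)) q
          rw [totalDegree_C] at this
          omega
      · intro y hy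
        rw [h y c0, hv y hy c (Finset.mem_insert_self _ _), hq' y hy]
        simp


/-- Projectors of trace `k`, over a general index type. -/
def Gr (ι : Type*) [Fintype ι] (k : ℕ) : Set (Matrix ι ι ℝ) :=
  {P | P.IsSymm ∧ P * P = P ∧ P.trace = k}

/-- Evaluation of a polynomial at a matrix. -/
noncomputable def evM {ι : Type*} (p : MvPolynomial (ι × ι) ℝ) (P : Matrix ι ι ℝ) : ℝ :=
  eval (fun ij => P ij.1 ij.2) p

theorem mem_og {ι : Type*} [Fintype ι] [DecidableEq ι] {o : Matrix ι ι ℝ} :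
    o ∈ unitaryGroup ι ℝ ↔ oᵀ * o = 1 := by
  rw [mem_unitaryGroup_iff', star_eq_conjTranspose, conjTranspose_eq_transpose_of_trivial]

theorem mem_og' {ι : Type*} [Fintype ι] [DecidableEq ι] {o : Matrix ι ι ℝ} :
    o ∈ unitaryGroup ι ℝ ↔ o * oᵀ = 1 := by
  rw [mem_unitaryGroup_iff, star_eq_conjTranspose, conjTranspose_eq_transpose_of_trivial]

theorem Gr_conj {ι : Type*} [Fintype ι] [DecidableEq ι] {k : ℕ} {P o : Matrix ι ι ℝ}
    (ho : o ∈ unitaryGroup ι ℝ) (hP : P ∈ Gr ι k) : o * P * oᵀ ∈ Gr ι k := by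
  obtain ⟨h1, h2, h3⟩ := hP
  rw [mem_og] at ho
  refine ⟨?_, ?_, ?_⟩
  · unfold IsSymm at *
    simp [h1, Matrix.mul_assoc]
  · calc o * P * oᵀ * (o * P * oᵀ) = o * P * (oᵀ * o) * P * oᵀ := by simp only [Matrix.mul_assoc]
      _ = o * (P * P) * oᵀ := by rw [ho]; simp only [Matrix.mul_assoc, Matrix.one_mul]
      _ = _ := by rw [h2]
  · rw [Matrix.trace_mul_comm, ← Matrix.mul_assoc, ho, Matrix.one_mul, h3]

theorem exists_conj_poly {ι : Type*} [Fintype ι] (o : Matrix ι ι ℝ) (p : MvPolynomial (ι × ι) ℝ) :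
    ∃ p' : MvPolynomial (ι × ι) ℝ, p'.totalDegree ≤ p.totalDegree ∧
      ∀ P, evM p' P = evM p (o * P * oᵀ) := by
  refine ⟨bind₁ (fun ij => ∑ b, ∑ a, C (o ij.1 a * o ij.2 b) * X (a, b)) p,
    totalDegree_bind_le _ ?_ p, ?_⟩
  · intro ij
    refine totalDegree_finsetSum_le fun b _ => totalDegree_finsetSum_le fun a _ => ?_
    refine (totalDegree_mul _ _).trans ?_
    rw [totalDegree_C, totalDegree_X, zero_add]
  · intro P
    unfold evM
    rw [eval_bind]
    congr 2
    ext ij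
    simp [Matrix.mul_apply, Finset.sum_mul]
    refine Finset.sum_congr rfl fun b _ => Finset.sum_congr rfl fun a _ => by ring

theorem compact_og (ι : Type*) [Fintype ι] [DecidableEq ι] : CompactSpace (unitaryGroup ι ℝ) := by
  refine (isCompact_iff_compactSpace (s := ((unitaryGroup ι ℝ : Submonoid _) : Set (Matrix ι ι ℝ)))).1 ?_
  have hsub : ((unitaryGroup ι ℝ : Submonoid _) : Set (Matrix ι ι ℝ)) ⊆
      Set.pi Set.univ (fun _ => Set.pi Set.univ fun _ => Set.Icc (-1 : ℝ) 1) := by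
    intro o ho i _ j _
    have h := entry_norm_bound_of_unitary ho i j
    rw [Real.norm_eq_abs, abs_le] at h
    exact h
  refine IsCompact.of_isClosed_subset
    (isCompact_univ_pi fun _ => isCompact_univ_pi fun _ => isCompact_Icc) ?_ hsub
  have : ((unitaryGroup ι ℝ : Submonoid _) : Set (Matrix ι ι ℝ)) = {o | oᵀ * o = 1} := by
    ext o; exact mem_og
  rw [this]
  exact isClosed_eq (by fun_prop) continuous_const

theorem spectral' {ι : Type*} [Fintype ι] [DecidableEq ι] {P : Matrix ι ι ℝ} (hP : P.IsSymm) :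
    ∃ (U : Matrix ι ι ℝ) (w : ι → ℝ), U ∈ unitaryGroup ι ℝ ∧ P = U * diagonal w * Uᵀ := by
  have hH : P.IsHermitian := by
    unfold IsHermitian; rw [conjTranspose_eq_transpose_of_trivial]; exact hP
  refine ⟨hH.eigenvectorUnitary, hH.eigenvalues, hH.eigenvectorUnitary.2, ?_⟩
  have := hH.spectral_theorem
  rw [Unitary.conjStarAlgAut_apply] at this
  simpa [star_eq_conjTranspose, conjTranspose_eq_transpose_of_trivial, Function.comp_def] using this

theorem Gr_trans {ι : Type*} [Fintype ι] [DecidableEq ι] (s : Finset ι) {P : Matrix ι ι ℝ}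
    (hP : P ∈ Gr ι s.card) : ∃ o ∈ unitaryGroup ι ℝ,
      P = o * diagonal (fun i => if i ∈ s then 1 else 0) * oᵀ := by
  obtain ⟨h1, h2, h3⟩ := hP
  obtain ⟨U, w, hU, hw⟩ := spectral' h1
  have hU' := mem_og.1 hU
  have hww : diagonal w = Uᵀ * P * U := by
    rw [hw]
    calc diagonal w = (Uᵀ * U) * diagonal w * (Uᵀ * U) := by rw [hU']; simp
      _ = _ := by simp only [Matrix.mul_assoc]
  have hid : ∀ i, w i * w i = w i := by
    have : diagonal w * diagonal w = diagonal w := by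
      rw [hww]
      calc Uᵀ * P * U * (Uᵀ * P * U) = Uᵀ * P * (U * Uᵀ) * P * U := by simp only [Matrix.mul_assoc]
        _ = Uᵀ * (P * P) * U := by rw [mem_og'.1 hU]; simp only [Matrix.mul_assoc, Matrix.one_mul]
        _ = _ := by rw [h2]
    rw [diagonal_mul_diagonal] at this
    intro i
    exact congrFun (diagonal_injective this) i
  have h01 : ∀ i, w i = if i ∈ Finset.univ.filter (fun i => w i = 1) then 1 else 0 := by
    intro i
    by_cases h : w i = 1
    · simp [h]
    · simp only [Finset.mem_filter, Finset.mem_univ, true_and, h, if_false]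
      have := hid i
      have h4 : w i * (w i - 1) = 0 := by linarith
      rcases mul_eq_zero.1 h4 with h5 | h5
      · exact h5
      · exact absurd (by linarith) h
  have hcard : (Finset.univ.filter (fun i => w i = 1)).card = s.card := by
    have : (∑ i, w i) = s.card := by
      rw [← h3, hw, Matrix.trace_mul_comm, ← Matrix.mul_assoc, hU', Matrix.one_mul, trace_diagonal]
    rw [Finset.sum_congr rfl (fun i _ => h01 i), Finset.sum_ite_mem] at this
    simpa using this
  let e : {i // i ∈ s} ≃ {i // i ∈ Finset.univ.filter (fun i => w i = 1)} :=
    Finset.equivOfCardEq hcard.symm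
  let σ : Equiv.Perm ι := e.extendSubtype
  have hσ : ∀ i, w (σ i) = if i ∈ s then 1 else 0 := by
    intro i
    rw [h01]
    by_cases h : i ∈ s
    · rw [if_pos h, if_pos (e.extendSubtype_mem i h)]
    · rw [if_neg h, if_neg (e.extendSubtype_not_mem i h)]
  refine ⟨U.submatrix id σ, ?_, ?_⟩
  · rw [mem_og, transpose_submatrix, ← submatrix_mul _ _ σ id σ Function.bijective_id, hU']
    exact submatrix_one_equiv σ
  · have : diagonal (fun i => if i ∈ s then (1:ℝ) else 0) = (diagonal w).submatrix σ σ := by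
      rw [submatrix_diagonal_equiv]
      congr 1
      ext i
      exact (hσ i).symm
    rw [this, transpose_submatrix, submatrix_mul_equiv, submatrix_mul_equiv, ← hw]
    rfl


theorem col_ext {m : Type*} [Fintype m] [DecidableEq m] {l : ℕ} (e : Fin l ↪ m)
    (M : Matrix m (Fin l) ℝ) (w : Fin l → ℝ) (h : Mᵀ * M = diagonal w) :
    (∀ a, 0 ≤ w a) ∧ ∃ B ∈ unitaryGroup m ℝ, ∀ i a, M i a = B i (e a) * √(w a) := by
  have hg : ∀ a b, ∑ i, M i a * M i b = if a = b then w a else 0 := by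
    intro a b
    have := congrFun (congrFun h a) b
    rw [diagonal_apply] at this
    rw [← this, Matrix.mul_apply]; rfl
  have hw : ∀ a, 0 ≤ w a := by
    intro a
    have := hg a a
    rw [if_pos rfl] at this
    rw [← this]
    exact Finset.sum_nonneg fun i _ => mul_self_nonneg _
  refine ⟨hw, ?_⟩
  let u : Fin l → EuclideanSpace ℝ m := fun a => (√(w a))⁻¹ • WithLp.toLp 2 (fun i => M i a)
  let v : m → EuclideanSpace ℝ m := Function.extend e u 0
  let s : Set m := {j | ∃ a, e a = j ∧ w a ≠ 0}
  have hv : ∀ a, v (e a) = u a := fun a => e.injective.extend_apply _ _ _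
  have hu : ∀ a b, inner ℝ (u a) (u b) = (√(w a))⁻¹ * (√(w b))⁻¹ * (if a = b then w a else 0) := by
    intro a b
    rw [← hg a b]
    simp only [u, inner_smul_left, inner_smul_right, PiLp.inner_apply]
    simp
    rw [mul_assoc, Finset.sum_congr rfl fun i _ => mul_comm (M i b) (M i a)]
    ring
  have hon : Orthonormal ℝ (s.domRestrict v) := by
    rw [orthonormal_iff_ite]
    rintro ⟨_, a, rfl, ha⟩ ⟨_, b, rfl, hb⟩
    show inner ℝ (v (e a)) (v (e b)) = _
    simp only [hv, hu, Subtype.mk.injEq, e.injective.eq_iff]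
    split_ifs with hab
    · subst hab
      rw [← mul_inv, Real.mul_self_sqrt (hw a), inv_mul_cancel₀ ha]
    · simp
  obtain ⟨b, hb⟩ := hon.exists_orthonormalBasis_extension_of_card_eq (by simp)
  refine ⟨of fun i j => b j i, ?_, ?_⟩
  · rw [mem_og]
    ext i j
    have := orthonormal_iff_ite.1 b.orthonormal i j
    rw [PiLp.inner_apply] at this
    simp only [Matrix.mul_apply, transpose_apply, of_apply, one_apply]
    rw [← this]
    exact Finset.sum_congr rfl fun x _ => mul_comm _ _
  · intro i a
    simp only [of_apply]
    by_cases ha : w a = 0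
    · have h0 := hg a a
      rw [if_pos rfl, ha, Finset.sum_eq_zero_iff_of_nonneg (fun i _ => mul_self_nonneg _)] at h0
      rw [ha, Real.sqrt_zero, mul_zero]
      exact mul_self_eq_zero.1 (h0 i (Finset.mem_univ i))
    · rw [hb (e a) ⟨a, rfl, ha⟩, hv]
      simp only [u]
      have : √(w a) ≠ 0 := (Real.sqrt_ne_zero (hw a)).2 ha
      simp
      field_simp

/-- The torus family. -/
def Tor {l n : ℕ} (y z : Fin l → ℝ) (D : Fin n → ℝ) :
    Matrix (Fin l ⊕ (Fin l ⊕ Fin n)) (Fin l ⊕ (Fin l ⊕ Fin n)) ℝ :=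
  fromBlocks (diagonal y) (fromCols (diagonal z) 0) (fromRows (diagonal z) 0)
    (diagonal (Sum.elim (1 - y) D))

theorem Tor_mem {l n m : ℕ} {y z : Fin l → ℝ} {D : Fin n → ℝ}
    (hz : ∀ a, z a ^ 2 = y a - y a ^ 2) (hD : ∀ b, D b ^ 2 = D b) (hm : ∑ b, D b = m) :
    Tor y z D ∈ Gr (Fin l ⊕ (Fin l ⊕ Fin n)) (l + m) := by
  refine ⟨?_, ?_, ?_⟩
  · ext (i | i | i) (j | j | j) <;>
      simp [Tor, diagonal_apply, eq_comm] <;> (try split_ifs) <;> simp_all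
  · ext (i | i | i) (j | j | j) <;>
      simp [Tor, Matrix.mul_apply, Fintype.sum_sum_type, diagonal_apply] <;>
      split_ifs with h <;> try subst h
    all_goals first | linear_combination hz i | linear_combination hD i | simp | skip
    all_goals ring
  · simp [Tor, Matrix.trace, Fintype.sum_sum_type, hm]
    ring

/-- The base point. -/
def P0 (l n : ℕ) : Matrix (Fin l ⊕ (Fin l ⊕ Fin n)) (Fin l ⊕ (Fin l ⊕ Fin n)) ℝ :=
  fromBlocks 1 0 0 0

theorem P0_trans {l n : ℕ} {P : Matrix (Fin l ⊕ (Fin l ⊕ Fin n)) (Fin l ⊕ (Fin l ⊕ Fin n)) ℝ}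
    (hP : P ∈ Gr _ l) : ∃ o ∈ unitaryGroup (Fin l ⊕ (Fin l ⊕ Fin n)) ℝ, P = o * P0 l n * oᵀ := by
  let s : Finset (Fin l ⊕ (Fin l ⊕ Fin n)) := Finset.univ.map Function.Embedding.inl
  have hs : s.card = l := by simp [s]
  have hP' : P ∈ Gr (Fin l ⊕ (Fin l ⊕ Fin n)) s.card := by rw [hs]; exact hP
  obtain ⟨o, ho, h⟩ := Gr_trans s hP'
  refine ⟨o, ho, ?_⟩
  rw [h]
  congr 2
  ext (i | i) (j | j) <;> simp [P0, s, diagonal_apply, one_apply]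

theorem P0_mem (l n : ℕ) : P0 l n ∈ Gr _ l := by
  refine ⟨?_, ?_, ?_⟩
  · simp [IsSymm, P0, fromBlocks_transpose]
  · simp [P0, fromBlocks_multiply]
  · simp [P0, Matrix.trace, Fintype.sum_sum_type]

theorem CS {l n : ℕ} {P : Matrix (Fin l ⊕ (Fin l ⊕ Fin n)) (Fin l ⊕ (Fin l ⊕ Fin n)) ℝ}
    (hP : P ∈ Gr _ l) : ∃ A ∈ unitaryGroup (Fin l) ℝ, ∃ B ∈ unitaryGroup (Fin l ⊕ Fin n) ℝ,
      ∃ y z : Fin l → ℝ, (∀ a, y a ∈ Set.Icc (0:ℝ) 1) ∧ (∀ a, z a ^ 2 = y a - y a ^ 2) ∧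
      P = fromBlocks A 0 0 B * Tor y z 0 * (fromBlocks A 0 0 B)ᵀ := by
  obtain ⟨o, ho, rfl⟩ := P0_trans hP
  rw [mem_og] at ho
  set V1 := o.toBlocks₁₁ with hV1
  set V2 := o.toBlocks₂₁ with hV2
  have hV : V1ᵀ * V1 + V2ᵀ * V2 = 1 := by
    have h := ho
    rw [← fromBlocks_toBlocks o, fromBlocks_transpose, fromBlocks_multiply,
      ← fromBlocks_one] at h
    exact (fromBlocks_inj.1 h).1
  obtain ⟨O, y, hO, hy⟩ := spectral' (P := V1ᵀ * V1) (by simp [IsSymm])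
  have hO1 := mem_og.1 hO
  have hO2 := mem_og'.1 hO
  have e1 : (V1 * O)ᵀ * (V1 * O) = diagonal y := by
    rw [transpose_mul]
    calc Oᵀ * V1ᵀ * (V1 * O) = Oᵀ * (V1ᵀ * V1) * O := by simp only [Matrix.mul_assoc]
      _ = (Oᵀ * O) * diagonal y * (Oᵀ * O) := by rw [hy]; simp only [Matrix.mul_assoc]
      _ = _ := by rw [hO1]; simp
  have e2 : (V2 * O)ᵀ * (V2 * O) = diagonal (1 - y) := by
    rw [transpose_mul]
    calc Oᵀ * V2ᵀ * (V2 * O) = Oᵀ * (V1ᵀ * V1 + V2ᵀ * V2) * O - (V1 * O)ᵀ * (V1 * O) := by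
          rw [transpose_mul]; simp only [Matrix.mul_assoc, Matrix.mul_add, Matrix.add_mul]; abel
      _ = _ := by
          rw [hV, e1, Matrix.mul_one, hO1, ← diagonal_one, diagonal_sub]; rfl
  obtain ⟨y0, A, hA, hA'⟩ := col_ext (Function.Embedding.refl _) _ _ e1
  obtain ⟨y1, B, hB, hB'⟩ := col_ext (Function.Embedding.inl : Fin l ↪ Fin l ⊕ Fin n) _ _ e2
  have hyy : ∀ a, 0 ≤ 1 - y a := y1
  refine ⟨A, hA, B, hB, y, fun a => √(y a) * √(1 - y a), fun a => ⟨y0 a, by linarith [hyy a]⟩, ?_, ?_⟩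
  · intro a
    rw [mul_pow, Real.sq_sqrt (y0 a), Real.sq_sqrt (hyy a)]; ring
  have hsq : ∀ a, √(y a) * √(y a) = y a := fun a => Real.mul_self_sqrt (y0 a)
  have hsq1 : ∀ a, √(1 - y a) * √(1 - y a) = 1 - y a := fun a => Real.mul_self_sqrt (hyy a)
  have hPb : o * P0 l n * oᵀ = fromBlocks ((V1 * O) * (V1 * O)ᵀ) ((V1 * O) * (V2 * O)ᵀ)
      ((V2 * O) * (V1 * O)ᵀ) ((V2 * O) * (V2 * O)ᵀ) := by
    have : ∀ {a b : Type} (X : Matrix a (Fin l) ℝ) (Y : Matrix b (Fin l) ℝ),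
        (X * O) * (Y * O)ᵀ = X * Yᵀ := by
      intro a b X Y
      rw [transpose_mul]
      calc X * O * (Oᵀ * Yᵀ) = X * (O * Oᵀ) * Yᵀ := by simp only [Matrix.mul_assoc]
        _ = _ := by rw [hO2, Matrix.mul_one]
    rw [this, this, this, this]
    conv_lhs => rw [← fromBlocks_toBlocks o]
    rw [P0, fromBlocks_transpose, fromBlocks_multiply, fromBlocks_multiply]
    simp [hV1, hV2]
  rw [hPb, Tor, fromBlocks_transpose, fromBlocks_multiply, fromBlocks_multiply]
  clear hPb e1 e2
  generalize V1 * O = W1 at *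
  generalize V2 * O = W2 at *
  congr 1
  · ext i j
    simp [Matrix.mul_apply (M := W1), hA', Matrix.mul_apply (N := Aᵀ), Matrix.mul_diagonal]
    refine Finset.sum_congr rfl fun a _ => ?_
    linear_combination (A i a * A j a) * hsq a
  · ext i j
    simp [Matrix.mul_apply (M := W1), hA', hB', Matrix.mul_apply, diagonal_apply]
    refine Finset.sum_congr rfl fun a _ => ?_
    ring
  · ext i j
    simp [Matrix.mul_apply (M := W2), hA', hB', Matrix.mul_apply, diagonal_apply]
    refine Finset.sum_congr rfl fun a _ => ?_
    ring
  · ext i j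
    simp [Matrix.mul_apply (M := W2), hA', hB', Matrix.mul_apply, diagonal_apply]
    refine Finset.sum_congr rfl fun a _ => ?_
    linear_combination (B i (Sum.inl a) * B j (Sum.inl a)) * hsq1 a


/-- Functions of the form `x ↦ R (c x)` with `R` a polynomial of degree at most `s`. -/
noncomputable def Filt {Y σ : Type*} (c : Y → σ → ℝ) (s : ℕ) : Submodule ℝ (Y → ℝ) where
  carrier := {F | ∃ R : MvPolynomial σ ℝ, R.totalDegree ≤ s ∧ ∀ x, F x = eval (c x) R}
  add_mem' := by
    rintro F G ⟨R, hR, hF⟩ ⟨S, hS, hG⟩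
    exact ⟨R + S, (totalDegree_add _ _).trans (max_le hR hS), fun x => by simp [hF, hG]⟩
  zero_mem' := ⟨0, by simp, by simp⟩
  smul_mem' := by
    rintro a F ⟨R, hR, hF⟩
    exact ⟨a • R, (totalDegree_smul_le _ _).trans hR, fun x => by simp [hF, smul_eval]⟩

theorem mem_Filt {Y σ : Type*} {c : Y → σ → ℝ} {s : ℕ} {F : Y → ℝ} :
    F ∈ Filt c s ↔ ∃ R : MvPolynomial σ ℝ, R.totalDegree ≤ s ∧ ∀ x, F x = eval (c x) R := Iff.rfl

theorem Filt_mono {Y σ : Type*} {c : Y → σ → ℝ} {s t : ℕ} (h : s ≤ t) : Filt c s ≤ Filt c t := by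
  rintro F ⟨R, hR, hF⟩
  exact ⟨R, hR.trans h, hF⟩

theorem Filt_const {Y σ : Type*} (c : Y → σ → ℝ) (s : ℕ) (a : ℝ) : (fun _ => a) ∈ Filt c s :=
  ⟨C a, by simp, by simp⟩

theorem Filt_coord {Y σ : Type*} (c : Y → σ → ℝ) (i : σ) : (fun x => c x i) ∈ Filt c 1 :=
  ⟨X i, by simp, by simp⟩

theorem Filt_mul {Y σ : Type*} {c : Y → σ → ℝ} {s t : ℕ} {F G : Y → ℝ} (hF : F ∈ Filt c s)
    (hG : G ∈ Filt c t) : F * G ∈ Filt c (s + t) := by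
  obtain ⟨R, hR, hF⟩ := hF
  obtain ⟨S, hS, hG⟩ := hG
  exact ⟨R * S, (totalDegree_mul _ _).trans (add_le_add hR hS), fun x => by simp [hF, hG]⟩

theorem Filt_prod {Y σ ι : Type*} {c : Y → σ → ℝ} (T : Finset ι) (s : ι → ℕ) (F : ι → Y → ℝ)
    (h : ∀ i ∈ T, F i ∈ Filt c (s i)) : (fun x => ∏ i ∈ T, F i x) ∈ Filt c (∑ i ∈ T, s i) := by
  choose! R hR hF using h
  exact ⟨∏ i ∈ T, R i, (totalDegree_finsetProd _ _).trans (Finset.sum_le_sum hR),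
    fun x => by rw [map_prod]; exact Finset.prod_congr rfl fun i hi => hF i hi x⟩

/-- Signs. -/
def sg (b : Bool) : ℝ := if b then 1 else -1

theorem Tor_poly {l n : ℕ}
    (p : MvPolynomial ((Fin l ⊕ (Fin l ⊕ Fin n)) × (Fin l ⊕ (Fin l ⊕ Fin n))) ℝ) :
    ∃ p' : MvPolynomial (Fin l ⊕ (Fin l ⊕ Fin n)) ℝ, p'.totalDegree ≤ p.totalDegree ∧
      ∀ y z D, evM p (Tor y z D) = eval (Sum.elim y (Sum.elim z D)) p' := by
  refine ⟨bind₁ (fun ij => match ij with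
    | (.inl a, .inl b) => if a = b then X (.inl a) else 0
    | (.inl a, .inr (.inl b)) => if a = b then X (.inr (.inl a)) else 0
    | (.inr (.inl a), .inl b) => if a = b then X (.inr (.inl a)) else 0
    | (.inr (.inl a), .inr (.inl b)) => if a = b then C 1 - X (.inl a) else 0
    | (.inr (.inr a), .inr (.inr b)) => if a = b then X (.inr (.inr a)) else 0
    | _ => 0) p, totalDegree_bind_le _ ?_ p, ?_⟩
  · rintro ⟨i | i | i, j | j | j⟩ <;> dsimp only <;> (try split_ifs) <;> (try simp)
    exact (totalDegree_sub _ _).trans (by simp)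
  · intro y z D
    rw [eval_bind]
    unfold evM
    congr 2
    ext ⟨i | i | i, j | j | j⟩ <;> simp [Tor, diagonal_apply] <;> split_ifs <;> simp

/-- Parameters of the torus family. -/
structure TP (l n : ℕ) where
  y : Fin l → ℝ
  z : Fin l → ℝ
  D : Fin n → ℝ
  hz : ∀ a, z a ^ 2 = y a - y a ^ 2
  hD : ∀ b, D b ^ 2 = D b

theorem avg {l n t : ℕ} (p : MvPolynomial ((Fin l ⊕ (Fin l ⊕ Fin n)) × (Fin l ⊕ (Fin l ⊕ Fin n))) ℝ)
    (hp : p.totalDegree ≤ t) :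
    (fun x : TP l n => ∑ ε : Fin l → Bool, ∑ σ : Equiv.Perm (Fin n),
      evM p (Tor x.y (fun a => sg (ε a) * x.z a) (fun b => x.D (σ b)))) ∈
      Filt (fun x : TP l n => (Sum.elim x.y (fun _ : Unit => ∑ b, x.D b))) t := by
  obtain ⟨p', hp', he⟩ := Tor_poly p
  simp only [he]
  set c := (fun x : TP l n => (Sum.elim x.y (fun _ : Unit => ∑ b, x.D b))) with hc
  have hy : ∀ a, (fun x : TP l n => x.y a) ∈ Filt c 1 := fun a => Filt_coord c (Sum.inl a)
  have key : ∀ m ∈ p'.support, (fun x : TP l n => ∑ ε : Fin l → Bool, ∑ σ : Equiv.Perm (Fin n),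
      eval (Sum.elim x.y (Sum.elim (fun a => sg (ε a) * x.z a) (fun b => x.D (σ b))))
        (monomial m (coeff m p'))) ∈ Filt c t := by
    intro m hm
    have hdeg : (∑ a, m (.inl a)) + ((∑ a, m (.inr (.inl a))) + ∑ b, m (.inr (.inr b))) ≤ t := by
      refine le_trans ?_ ((le_totalDegree hm).trans (hp'.trans hp))
      rw [Finsupp.sum_fintype _ _ (fun _ => rfl), Fintype.sum_sum_type, Fintype.sum_sum_type]
    have f1 : (fun x : TP l n => ∏ a, x.y a ^ m (.inl a)) ∈ Filt c (∑ a, m (.inl a)) := by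
      refine Filt_prod _ _ _ fun a _ => ?_
      have := Filt_prod (c := c) (Finset.range (m (.inl a))) (fun _ => 1)
        (fun _ (x : TP l n) => x.y a) (fun _ _ => hy a)
      simpa using this
    have f2 : (fun x : TP l n => ∏ a, ∑ b : Bool, (sg b * x.z a) ^ m (.inr (.inl a))) ∈
        Filt c (∑ a, m (.inr (.inl a))) := by
      refine Filt_prod _ _ _ fun a _ => ?_
      rcases Nat.even_or_odd' (m (.inr (.inl a))) with ⟨k, hk | hk⟩
      · rw [hk]
        have h2 : (fun x : TP l n => x.y a - x.y a ^ 2) ∈ Filt c 2 :=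
          sub_mem (Filt_mono (by norm_num) (hy a)) (by
            have := Filt_mul (hy a) (hy a)
            convert this using 2
            simp [pow_two])
        have := Filt_prod (c := c) (Finset.range k) (fun _ => 2) _ (fun _ _ => h2)
        have h3 := Submodule.smul_mem _ (2:ℝ) this
        convert h3 using 1
        · simp [mul_comm]
        · ext x
          simp [sg, pow_mul, x.hz]
      · rw [hk]
        convert Submodule.zero_mem _ using 1
        ext x
        simp [sg, mul_pow, pow_mul, pow_succ]
    have f3 : (fun x : TP l n => ∑ σ : Equiv.Perm (Fin n), ∏ b, x.D (σ b) ^ m (.inr (.inr b))) ∈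
        Filt c (∑ b, m (.inr (.inr b))) := by
      refine perm_sum_mem (fun x : TP l n => x.D) (Filt c) (Filt_const c 0 1)
        (fun s t f g hf hg => Filt_mul hf hg) ?_ _
      intro b
      rcases b with _ | b
      · simpa using Filt_const c 0 (n : ℝ)
      · have h1 : ∀ (x : TP l n) a, x.D a ^ (b + 1) = x.D a := by
          intro x a
          induction b with
          | zero => simp
          | succ b ih => rw [pow_succ, ih, ← pow_two, x.hD]
        simp only [h1]
        exact Filt_mono (by omega) (Filt_coord c (Sum.inr ()))
    have := Submodule.smul_mem _ (coeff m p') (Filt_mono hdeg (Filt_mul f1 (Filt_mul f2 f3)))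
    convert this using 1
    ext x
    simp only [eval_monomial, Pi.smul_apply, Pi.mul_apply, smul_eq_mul]
    rw [Finset.prod_univ_sum, Finset.sum_mul_sum, Finset.mul_sum, Finset.mul_sum]
    refine Finset.sum_congr Fintype.piFinset_univ.symm fun ε _ => ?_
    rw [Finset.mul_sum, Finset.mul_sum]
    refine Finset.sum_congr rfl fun σ _ => ?_
    rw [Finsupp.prod_fintype _ _ (fun _ => pow_zero _), Fintype.prod_sum_type, Fintype.prod_sum_type]
    rfl
  have := Submodule.sum_mem _ key
  convert this using 1
  ext x
  rw [Finset.sum_apply, Finset.sum_comm]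
  rw [Finset.sum_comm]
  conv_lhs => enter [2, ε, 2, σ]; rw [p'.as_sum, map_sum]
  simp only [Finset.sum_comm (s := p'.support)]


/-- The ambient index type. -/
abbrev Ix (l n : ℕ) := Fin l ⊕ (Fin l ⊕ Fin n)

theorem perm_conj {ι : Type*} [Fintype ι] [DecidableEq ι] (τ : Equiv.Perm ι) (T : Matrix ι ι ℝ) :
    ((1 : Matrix ι ι ℝ).submatrix τ id) * T * ((1 : Matrix ι ι ℝ).submatrix τ id)ᵀ
      = T.submatrix τ τ := by
  ext i j
  simp [Matrix.mul_apply, one_apply]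

theorem perm_og {ι : Type*} [Fintype ι] [DecidableEq ι] (τ : Equiv.Perm ι) :
    (1 : Matrix ι ι ℝ).submatrix τ id ∈ unitaryGroup ι ℝ := by
  rw [mem_og']
  have := perm_conj τ 1
  rw [Matrix.mul_one] at this
  rw [this]
  exact submatrix_one_equiv τ

theorem Tor_perm {l n : ℕ} (y z : Fin l → ℝ) (σ : Equiv.Perm (Fin l)) :
    ∃ A ∈ unitaryGroup (Fin l) ℝ, ∃ B ∈ unitaryGroup (Fin l ⊕ Fin n) ℝ,
      Tor (y ∘ σ) (z ∘ σ) 0 = fromBlocks A 0 0 B * Tor y z 0 * (fromBlocks A 0 0 B)ᵀ := by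
  refine ⟨_, perm_og σ, _, perm_og (Equiv.sumCongr σ (Equiv.refl (Fin n))), ?_⟩
  have : fromBlocks ((1 : Matrix _ _ ℝ).submatrix σ id) 0 0
      ((1 : Matrix _ _ ℝ).submatrix (Equiv.sumCongr σ (Equiv.refl (Fin n))) id) =
      (1 : Matrix (Ix l n) (Ix l n) ℝ).submatrix
        (Equiv.sumCongr σ (Equiv.sumCongr σ (Equiv.refl (Fin n)))) id := by
    ext (i | i | i) (j | j | j) <;> simp [one_apply]
  rw [this, perm_conj]
  ext (i | i | i) (j | j | j) <;> simp [Tor, diagonal_apply]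

theorem sg_sq (b : Bool) : sg b * sg b = 1 := by cases b <;> simp [sg]

theorem Tor_sign {l n : ℕ} (y z : Fin l → ℝ) (ε : Fin l → Bool) :
    ∃ A ∈ unitaryGroup (Fin l) ℝ, ∃ B ∈ unitaryGroup (Fin l ⊕ Fin n) ℝ,
      Tor y (fun a => sg (ε a) * z a) 0 =
        fromBlocks A 0 0 B * Tor y z 0 * (fromBlocks A 0 0 B)ᵀ := by
  refine ⟨diagonal fun a => sg (ε a), ?_, 1, one_mem _, ?_⟩
  · rw [mem_og, diagonal_transpose, diagonal_mul_diagonal]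
    simp [sg_sq]
  · rw [Tor, Tor, fromBlocks_transpose, fromBlocks_multiply, fromBlocks_multiply]
    congr 1
    · simp
      intro a
      linear_combination (- y a) * sg_sq (ε a)
    · ext i (j | j) <;> simp
    · ext (i | i) j <;> simp 
      simp [diagonal_apply]
      split_ifs with h
      · subst h; ring
      · rfl
    · simp

/-- Invariance under the block-diagonal orthogonal group. -/
def IsInv {l n : ℕ} (S : Set (Matrix (Ix l n) (Ix l n) ℝ)) (u : MvPolynomial (Ix l n × Ix l n) ℝ) :
    Prop :=
  ∀ A ∈ unitaryGroup (Fin l) ℝ, ∀ B ∈ unitaryGroup (Fin l ⊕ Fin n) ℝ, ∀ P ∈ S,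
    evM u (fromBlocks A 0 0 B * P * (fromBlocks A 0 0 B)ᵀ) = evM u P

theorem pow_poly {l n : ℕ} (b : ℕ) : ∀ i j, ∃ u : MvPolynomial (Ix l n × Ix l n) ℝ,
    u.totalDegree ≤ b ∧ ∀ P, evM u P = (P.toBlocks₁₁ ^ b) i j := by
  induction b with
  | zero =>
    intro i j
    exact ⟨C ((1 : Matrix (Fin l) (Fin l) ℝ) i j), by simp, by simp [evM]⟩
  | succ b ih =>
    intro i j
    choose w hw1 hw2 using ih
    refine ⟨∑ k, w i k * X (Sum.inl k, Sum.inl j), ?_, ?_⟩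
    · refine totalDegree_finsetSum_le fun k _ => (totalDegree_mul _ _).trans ?_
      rw [totalDegree_X]
      exact Nat.add_le_add_right (hw1 i k) 1
    · intro P
      rw [pow_succ, Matrix.mul_apply]
      simp only [evM, map_sum, map_mul, eval_X]
      refine Finset.sum_congr rfl fun k _ => ?_
      rw [← hw2 i k P]; rfl

theorem trace_poly {l n : ℕ} (b : ℕ) : ∃ u : MvPolynomial (Ix l n × Ix l n) ℝ,
    u.totalDegree ≤ b ∧ IsInv Set.univ u ∧ ∀ y z, evM u (Tor y z 0) = ∑ a, y a ^ b := by
  choose w hw1 hw2 using pow_poly (l := l) (n := n) b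
  have ht : ∀ P, evM (∑ a, w a a) P = trace (P.toBlocks₁₁ ^ b) := by
    intro P
    rw [Matrix.trace]
    simp only [diag_apply, ← hw2]
    simp [evM]
  refine ⟨∑ a, w a a, totalDegree_finsetSum_le fun a _ => hw1 a a, ?_, ?_⟩
  · intro A hA B hB P _
    rw [ht, ht]
    have h1 : (fromBlocks A 0 0 B * P * (fromBlocks A 0 0 B)ᵀ).toBlocks₁₁ =
        A * P.toBlocks₁₁ * Aᵀ := by
      conv_lhs => rw [← fromBlocks_toBlocks P]
      rw [fromBlocks_transpose, fromBlocks_multiply, fromBlocks_multiply]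
      simp
    have h2 : ∀ b, (A * P.toBlocks₁₁ * Aᵀ) ^ b = A * P.toBlocks₁₁ ^ b * Aᵀ := by
      intro b
      induction b with
      | zero => simp [mem_og'.1 hA]
      | succ b ih =>
        rw [pow_succ, ih, pow_succ]
        calc _ = A * P.toBlocks₁₁ ^ b * (Aᵀ * A) * P.toBlocks₁₁ * Aᵀ := by
              simp only [Matrix.mul_assoc]
          _ = _ := by rw [mem_og.1 hA]; simp only [Matrix.mul_assoc, Matrix.one_mul]
    rw [h1, h2, Matrix.trace_mul_comm, ← Matrix.mul_assoc, mem_og.1 hA, Matrix.one_mul]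
  · intro y z
    rw [ht]
    simp [Tor, diagonal_pow]

/-- Restrictions to the torus of invariant polynomials of degree at most `s`. -/
noncomputable def InvF (l n s : ℕ) : Submodule ℝ (TP l n → ℝ) where
  carrier := {F | ∃ u : MvPolynomial (Ix l n × Ix l n) ℝ, u.totalDegree ≤ s ∧ IsInv Set.univ u ∧
    ∀ x : TP l n, evM u (Tor x.y x.z 0) = F x}
  add_mem' := by
    rintro F G ⟨u, hu, hi, hF⟩ ⟨v, hv, hj, hG⟩
    refine ⟨u + v, (totalDegree_add _ _).trans (max_le hu hv), ?_, fun x => by simp [← hF, ← hG, evM]⟩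
    intro A hA B hB P hP
    have h1 := hi A hA B hB P hP
    have h2 := hj A hA B hB P hP
    unfold evM at *
    rw [map_add, map_add, h1, h2]
  zero_mem' := ⟨0, by simp, by intro A hA B hB P hP; simp [evM], by simp [evM]⟩
  smul_mem' := by
    rintro a F ⟨u, hu, hi, hF⟩
    refine ⟨a • u, (totalDegree_smul_le _ _).trans hu, ?_, fun x => by simp [← hF, evM, smul_eval]⟩
    intro A hA B hB P hP
    have h1 := hi A hA B hB P hP
    unfold evM at *
    rw [smul_eval, smul_eval, h1]

theorem InvF_mul {l n s t : ℕ} {F G : TP l n → ℝ} (hF : F ∈ InvF l n s) (hG : G ∈ InvF l n t) :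
    F * G ∈ InvF l n (s + t) := by
  obtain ⟨u, hu, hi, hF⟩ := hF
  obtain ⟨v, hv, hj, hG⟩ := hG
  refine ⟨u * v, (totalDegree_mul _ _).trans (add_le_add hu hv), ?_, fun x => by simp [← hF, ← hG, evM]⟩
  intro A hA B hB P hP
  have h1 := hi A hA B hB P hP
  have h2 := hj A hA B hB P hP
  unfold evM at *
  rw [map_mul, map_mul, h1, h2]

theorem InvF_sym {l n s : ℕ} (q : MvPolynomial (Fin l) ℝ) (hq : q.totalDegree ≤ s) :
    (fun x : TP l n => ∑ σ : Equiv.Perm (Fin l), eval (x.y ∘ σ) q) ∈ InvF l n s := by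
  have key : ∀ m ∈ q.support, (fun x : TP l n => ∑ σ : Equiv.Perm (Fin l),
      eval (x.y ∘ σ) (monomial m (coeff m q))) ∈ InvF l n s := by
    intro m hm
    have h := perm_sum_mem (fun x : TP l n => x.y) (InvF l n)
      ⟨1, by simp, by intro A hA B hB P hP; simp [evM], by simp [evM]⟩
      (fun s t f g hf hg => InvF_mul hf hg)
      (fun b => by
        obtain ⟨u, hu, hi, hy⟩ := trace_poly (l := l) (n := n) b
        exact ⟨u, hu, hi, fun x => hy _ _⟩) m
    have h' := Submodule.smul_mem _ (coeff m q) h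
    have hle : ∑ c, m c ≤ s := by
      refine le_trans ?_ ((le_totalDegree hm).trans hq)
      rw [Finsupp.sum_fintype _ _ (fun _ => rfl)]
    obtain ⟨u, hu, hi, hy⟩ := h'
    refine ⟨u, hu.trans hle, hi, fun x => ?_⟩
    rw [hy]
    simp only [Pi.smul_apply, smul_eq_mul, eval_monomial, Finset.mul_sum]
    refine Finset.sum_congr rfl fun σ _ => ?_
    rw [Finsupp.prod_fintype _ _ (fun _ => pow_zero _)]
    rfl
  have := Submodule.sum_mem _ key
  convert this using 1
  ext x
  rw [Finset.sum_apply, Finset.sum_comm]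
  refine Finset.sum_congr rfl fun σ _ => ?_
  conv_lhs => rw [q.as_sum, map_sum]


theorem core_inv {l n t : ℕ} (K : Finset ℕ) (hK : ∀ k ∈ K, l < k ∧ k ≤ l + n)
    (p : MvPolynomial (Ix l n × Ix l n) ℝ) (hp : p.totalDegree ≤ t)
    (hv : ∀ k ∈ K, ∀ P ∈ Gr (Ix l n) k, evM p P = 0) (hi : IsInv (Gr (Ix l n) l) p) :
    ∃ u : MvPolynomial (Ix l n × Ix l n) ℝ, (u = 0 ∨ u.totalDegree + K.card ≤ t) ∧
      ∀ P ∈ Gr (Ix l n) l, evM p P = evM u P := by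
  classical
  obtain ⟨R, hR, hRe⟩ := avg p hp
  let Y : Set (Fin l → ℝ) := {y | ∀ a, y a ∈ Set.Icc (0:ℝ) 1}
  have hz : ∀ y ∈ Y, ∀ a, (√(y a - y a ^ 2)) ^ 2 = y a - y a ^ 2 := by
    intro y hy a
    obtain ⟨h0, h1⟩ := hy a
    exact Real.sq_sqrt (by nlinarith)
  have hYx : ∀ x : TP l n, x.y ∈ Y := by
    intro x a
    have := x.hz a
    constructor <;> nlinarith [sq_nonneg (x.z a), sq_nonneg (x.y a)]
  have hsz : ∀ (x : TP l n) (ε : Fin l → Bool) a,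
      (sg (ε a) * x.z a) ^ 2 = x.y a - x.y a ^ 2 := by
    intro x ε a
    rw [mul_pow, x.hz, pow_two (sg _), sg_sq, one_mul]
  obtain ⟨q, hq, hqe⟩ := peel_all Y 0 (K.image fun k : ℕ => (k : ℝ) - l) t R hR
    (by
      intro h0
      obtain ⟨k, hk, h⟩ := Finset.mem_image.1 h0
      have := (hK k hk).1
      have : (l : ℝ) < k := by exact_mod_cast this
      linarith)
    (by
      intro y hy c hc
      obtain ⟨k, hk, rfl⟩ := Finset.mem_image.1 hc
      obtain ⟨m, rfl⟩ := Nat.exists_eq_add_of_lt (hK k hk).1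
      have hmn : m + 1 ≤ n := by have := (hK _ hk).2; omega
      have hsum : ∑ b : Fin n, (if (b : ℕ) < m + 1 then (1:ℝ) else 0) = ((m + 1 : ℕ) : ℝ) := by
        rw [Finset.sum_boole, Fin.card_filter_val_lt, min_eq_right hmn]
      let x : TP l n := ⟨y, fun a => √(y a - y a ^ 2), fun b => if (b : ℕ) < m + 1 then 1 else 0,
        hz y hy, fun b => by split_ifs <;> simp⟩
      have := hRe x
      have hc' : ((l + m + 1 : ℕ) : ℝ) - l = ∑ b, x.D b := by
        rw [hsum]; push_cast; ring
      rw [hc', show y = x.y from rfl, ← this]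
      refine Finset.sum_eq_zero fun ε _ => Finset.sum_eq_zero fun σ _ => ?_
      refine hv (l + (m + 1)) hk _ (Tor_mem (hsz x ε) (fun b => x.hD _) ?_)
      rw [Equiv.sum_comp σ x.D]
      exact hsum)
  have hcard : (K.image fun k : ℕ => (k : ℝ) - l).card = K.card :=
    Finset.card_image_of_injective _ fun a b h => by
      have : (a : ℝ) = b := by simpa using h
      exact_mod_cast this
  rw [hcard] at hq
  set N : ℝ := (Fintype.card (Fin l → Bool) : ℝ) * (Fintype.card (Equiv.Perm (Fin n)) : ℝ) with hN
  have hN0 : N ≠ 0 := by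
    rw [hN]
    exact mul_ne_zero (Nat.cast_ne_zero.2 Fintype.card_ne_zero)
      (Nat.cast_ne_zero.2 Fintype.card_ne_zero)
  have hTm : ∀ y z : Fin l → ℝ, (∀ a, z a ^ 2 = y a - y a ^ 2) →
      Tor y z (0 : Fin n → ℝ) ∈ Gr (Ix l n) l := by
    intro y z h
    exact Tor_mem (m := 0) h (by simp) (by simp)
  have h1 : ∀ x : TP l n, eval x.y q = N * evM p (Tor x.y x.z 0) := by
    intro x
    let x' : TP l n := ⟨x.y, x.z, 0, x.hz, by simp⟩
    rw [← hqe x.y (hYx x)]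
    have := hRe x'
    have h0 : ∑ b, x'.D b = 0 := by simp [x']
    simp only [h0] at this
    rw [show x'.y = x.y from rfl] at this
    rw [← this]
    have hs : ∀ ε : Fin l → Bool, ∀ σ : Equiv.Perm (Fin n),
        evM p (Tor x.y (fun a => sg (ε a) * x'.z a) (fun b => x'.D (σ b))) =
          evM p (Tor x.y x.z 0) := by
      intro ε σ
      obtain ⟨A, hA, B, hB, h⟩ := Tor_sign (n := n) x.y x.z ε
      rw [← hi A hA B hB _ (hTm _ _ x.hz), ← h]
      rfl
    simp only [hs]
    simp [hN, mul_assoc]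
  set M : ℝ := (Fintype.card (Equiv.Perm (Fin l)) : ℝ) with hM
  have hM0 : M ≠ 0 := Nat.cast_ne_zero.2 Fintype.card_ne_zero
  have h2 : ∀ x : TP l n, ∑ σ : Equiv.Perm (Fin l), eval (x.y ∘ σ) q =
      M * N * evM p (Tor x.y x.z 0) := by
    intro x
    have hs : ∀ σ : Equiv.Perm (Fin l), eval (x.y ∘ σ) q = N * evM p (Tor x.y x.z 0) := by
      intro σ
      have := h1 ⟨x.y ∘ σ, x.z ∘ σ, x.D, fun a => x.hz _, x.hD⟩
      rw [this]
      obtain ⟨A, hA, B, hB, h⟩ := Tor_perm (n := n) x.y x.z σ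
      simp only
      rw [h, hi A hA B hB _ (hTm _ _ x.hz)]
    simp only [hs]
    simp [hM, mul_assoc]
  have hfin : ∃ u : MvPolynomial (Ix l n × Ix l n) ℝ, (u = 0 ∨ u.totalDegree + K.card ≤ t) ∧
      IsInv Set.univ u ∧ ∀ x : TP l n, evM u (Tor x.y x.z 0) = evM p (Tor x.y x.z 0) := by
    rcases hq with rfl | hq
    · refine ⟨0, Or.inl rfl, by intro A hA B hB P hP; simp [evM], fun x => ?_⟩
      have := h2 x
      simp only [map_zero, Finset.sum_const_zero] at this
      have h3 := (mul_eq_zero.1 this.symm).resolve_left (mul_ne_zero hM0 hN0)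
      rw [h3]; simp [evM]
    · obtain ⟨u, hu, hui, hue⟩ := Submodule.smul_mem _ (M * N)⁻¹ (InvF_sym (n := n) q le_rfl)
      refine ⟨u, Or.inr (by omega), hui, fun x => ?_⟩
      rw [hue]
      simp only [Pi.smul_apply, smul_eq_mul, h2]
      rw [inv_mul_cancel_left₀ (mul_ne_zero hM0 hN0)]
  obtain ⟨u, hu, hui, hue⟩ := hfin
  refine ⟨u, hu, fun P hP => ?_⟩
  obtain ⟨A, hA, B, hB, y, z, hy, hz, rfl⟩ := CS hP
  rw [hui A hA B hB _ (Set.mem_univ _), hi A hA B hB _ (hTm _ _ hz)]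
  exact (hue ⟨y, z, 0, hz, by simp⟩).symm

theorem block_og {l n : ℕ} {A : Matrix (Fin l) (Fin l) ℝ} (hA : A ∈ unitaryGroup (Fin l) ℝ)
    {B : Matrix (Fin l ⊕ Fin n) (Fin l ⊕ Fin n) ℝ} (hB : B ∈ unitaryGroup (Fin l ⊕ Fin n) ℝ) :
    fromBlocks A 0 0 B ∈ unitaryGroup (Ix l n) ℝ := by
  rw [mem_og, fromBlocks_transpose, fromBlocks_multiply]
  simp [mem_og.1 hA, mem_og.1 hB]

/-- Pullback of a polynomial to the orthogonal group along the orbit of the base point. -/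
noncomputable def pull (l n : ℕ) :
    MvPolynomial (Ix l n × Ix l n) ℝ →ₗ[ℝ] (unitaryGroup (Ix l n) ℝ → ℝ) where
  toFun p := fun o => evM p (o.1 * P0 l n * o.1ᵀ)
  map_add' p q := by funext o; simp [evM]
  map_smul' c p := by funext o; simp [evM, smul_eval]

theorem core {l n t : ℕ} (K : Finset ℕ) (hK : ∀ k ∈ K, l < k ∧ k ≤ l + n)
    (p : MvPolynomial (Ix l n × Ix l n) ℝ) (hp : p.totalDegree ≤ t)
    (hv : ∀ k ∈ K, ∀ P ∈ Gr (Ix l n) k, evM p P = 0) :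
    ∃ u : MvPolynomial (Ix l n × Ix l n) ℝ, (u = 0 ∨ u.totalDegree + K.card ≤ t) ∧
      ∀ P ∈ Gr (Ix l n) l, evM p P = evM u P := by
  have := compact_og (Ix l n)
  let W : Submodule ℝ (MvPolynomial (Ix l n × Ix l n) ℝ) :=
    { carrier := {p | p.totalDegree ≤ t ∧ ∀ k ∈ K, ∀ P ∈ Gr (Ix l n) k, evM p P = 0}
      add_mem' := by
        rintro p q ⟨h1, h2⟩ ⟨h3, h4⟩
        refine ⟨(totalDegree_add _ _).trans (max_le h1 h3), fun k hk P hP => ?_⟩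
        have a := h2 k hk P hP
        have b := h4 k hk P hP
        unfold evM at *
        rw [map_add, a, b, add_zero]
      zero_mem' := ⟨by simp, by simp [evM]⟩
      smul_mem' := by
        rintro c p ⟨h1, h2⟩
        refine ⟨(totalDegree_smul_le _ _).trans h1, fun k hk P hP => ?_⟩
        have a := h2 k hk P hP
        unfold evM at *
        rw [smul_eval, a, mul_zero] }
  have hWfin : FiniteDimensional ℝ W :=
    Submodule.finiteDimensional_of_le (S₂ := restrictTotalDegree (Ix l n × Ix l n) ℝ t)
      (fun p hp => (mem_restrictTotalDegree _ _ _).2 hp.1)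
  let U : Submodule ℝ (unitaryGroup (Ix l n) ℝ → ℝ) := W.map (pull l n)
  have hUfin : FiniteDimensional ℝ U := inferInstance
  have hshift : ∀ (p : MvPolynomial (Ix l n × Ix l n) ℝ) (g : unitaryGroup (Ix l n) ℝ),
      ∃ p' : MvPolynomial (Ix l n × Ix l n) ℝ, p'.totalDegree ≤ p.totalDegree ∧
        (∀ P, evM p' P = evM p (g.1 * P * g.1ᵀ)) ∧
        pull l n p' = fun x => pull l n p (g * x) := by
    intro p g
    obtain ⟨p', h1, h2⟩ := exists_conj_poly g.1 p
    refine ⟨p', h1, h2, ?_⟩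
    funext x
    show evM p' _ = evM p _
    rw [h2]
    congr 1
    rw [Submonoid.coe_mul, transpose_mul]
    simp only [Matrix.mul_assoc]
  obtain ⟨h, ⟨p1, hp1, rfl⟩, hinv, hgen⟩ := haar_lemma U
    (by
      rintro _ ⟨p, hp, rfl⟩
      show Continuous fun o : unitaryGroup (Ix l n) ℝ => eval _ p
      refine (MvPolynomial.continuous_eval p).comp ?_
      have h1 : Continuous fun o : unitaryGroup (Ix l n) ℝ => o.1 * P0 l n * o.1ᵀ := by fun_prop
      exact continuous_pi fun ij => h1.matrix_elem ij.1 ij.2)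
    (by
      rintro _ ⟨p, hp, rfl⟩ g
      obtain ⟨p', h1, h2, h3⟩ := hshift p g
      refine ⟨p', ⟨h1.trans hp.1, fun k hk P hP => ?_⟩, h3⟩
      rw [h2]
      exact hp.2 k hk _ (Gr_conj g.2 hP))
  have hi : IsInv (Gr (Ix l n) l) p1 := by
    intro A hA B hB P hP
    obtain ⟨o, ho, rfl⟩ := P0_trans hP
    let g : unitaryGroup (Ix l n) ℝ := ⟨_, block_og hA hB⟩
    have hg0 : g⁻¹.1 = fromBlocks Aᵀ 0 0 Bᵀ := by
      show star (fromBlocks A 0 0 B) = _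
      rw [star_eq_conjTranspose, conjTranspose_eq_transpose_of_trivial, fromBlocks_transpose]
      simp
    have := hinv g (by
      rintro _ ⟨p, hp, rfl⟩
      show evM p (g⁻¹.1 * P0 l n * g⁻¹.1ᵀ) = evM p ((1 : unitaryGroup (Ix l n) ℝ).1 * _ * _)
      congr 1
      rw [hg0, P0, fromBlocks_transpose, fromBlocks_multiply, fromBlocks_multiply]
      simp [mem_og.1 hA]) ⟨o, ho⟩
    have h2 : evM p1 ((g * ⟨o, ho⟩ : unitaryGroup (Ix l n) ℝ).1 * P0 l n *
      (g * ⟨o, ho⟩ : unitaryGroup (Ix l n) ℝ).1ᵀ) = evM p1 (o * P0 l n * oᵀ) := this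
    rw [← h2]
    congr 1
    rw [Submonoid.coe_mul, transpose_mul]
    simp only [Matrix.mul_assoc, g]
  obtain ⟨u1, hu1, hu1e⟩ := core_inv K hK p1 hp1.1 hp1.2 hi
  let W' : Submodule ℝ (MvPolynomial (Ix l n × Ix l n) ℝ) :=
    { carrier := {u | u = 0 ∨ u.totalDegree + K.card ≤ t}
      add_mem' := by
        rintro p q (rfl | h1) (rfl | h2)
        · left; simp
        · right; simpa using h2
        · right; simpa using h1
        · right
          have := totalDegree_add p q
          have := max_le_iff.1 (le_refl (max p.totalDegree q.totalDegree))
          rcases le_total p.totalDegree q.totalDegree with h | h <;> simp [h] at * <;> omega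
      zero_mem' := Or.inl rfl
      smul_mem' := by
        rintro c p (rfl | h1)
        · left; simp
        · right
          have := totalDegree_smul_le c p
          omega }
  have hle := hgen (W'.map (pull l n)) (by
      rintro _ ⟨u, hu, rfl⟩ g
      rcases hu with rfl | hu
      · refine ⟨0, Or.inl rfl, ?_⟩
        rw [map_zero]; rfl
      · obtain ⟨p', h1, h2, h3⟩ := hshift u g
        exact ⟨p', Or.inr (by omega), h3⟩)
    ⟨u1, hu1, by
      funext o
      exact (hu1e _ (Gr_conj o.2 (P0_mem l n))).symm⟩
  obtain ⟨u, hu, hue⟩ := hle ⟨p, ⟨hp, hv⟩, rfl⟩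
  refine ⟨u, hu, fun P hP => ?_⟩
  obtain ⟨o, ho, rfl⟩ := P0_trans hP
  exact (congrFun hue ⟨o, ho⟩).symm

theorem key_small {d t j : ℕ} (hj : 2 * j ≤ d) (K : Finset ℕ) (hK : ∀ k ∈ K, j < k ∧ k + j ≤ d)
    (p : MvPolynomial (Fin d × Fin d) ℝ) (hp : p.totalDegree ≤ t)
    (hv : ∀ k ∈ K, ∀ P ∈ Gr (Fin d) k, evM p P = 0) :
    ∃ u : MvPolynomial (Fin d × Fin d) ℝ, (u = 0 ∨ u.totalDegree + K.card ≤ t) ∧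
      ∀ P ∈ Gr (Fin d) j, evM p P = evM u P := by
  obtain ⟨n, rfl⟩ := Nat.exists_eq_add_of_le hj
  let e : Ix j n ≃ Fin (2 * j + n) := Fintype.equivOfCardEq (by simp [Ix]; ring)
  have hren : ∀ {a b : Type} (f : a ≃ b) (q : MvPolynomial (a × a) ℝ) (P : Matrix b b ℝ),
      evM (rename (Prod.map f f) q) P = evM q (P.submatrix f f) := by
    intro a b f q P
    simp only [evM, eval_rename]
    rfl
  have hGr : ∀ {a b : Type} [Fintype a] [Fintype b] (f : a ≃ b) (k : ℕ) (P : Matrix b b ℝ),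
      P ∈ Gr b k → P.submatrix f f ∈ Gr a k := by
    intro a b _ _ f k P hP
    obtain ⟨h1, h2, h3⟩ := hP
    refine ⟨h1.submatrix f, ?_, ?_⟩
    · rw [submatrix_mul_equiv, h2]
    · rw [← h3]
      exact Equiv.sum_comp f (fun i => P i i)
  obtain ⟨u, hu, hue⟩ := core (l := j) (n := n) (t := t) K
    (fun k hk => ⟨(hK k hk).1, by have := (hK k hk).2; omega⟩)
    (rename (Prod.map e.symm e.symm) p) ((totalDegree_rename_le _ _).trans hp)
    (by
      intro k hk P hP
      rw [hren e.symm]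
      exact hv k hk _ (hGr e.symm k P hP))
  refine ⟨rename (Prod.map e e) u, ?_, fun P hP => ?_⟩
  · rcases hu with rfl | hu
    · left; simp
    · right
      have := totalDegree_rename_le (Prod.map e e) u
      omega
  · have := hue _ (hGr e j P hP)
    rw [hren e.symm] at this
    rw [hren e, ← this]
    simp

theorem key_claim {d t j : ℕ} (hj : j ≤ d) (K : Finset ℕ)
    (hK : ∀ k ∈ K, k ≤ d ∧ min j (d - j) ≤ min k (d - k)) (hjK : j ∉ K)
    (p : MvPolynomial (Fin d × Fin d) ℝ) (hp : p.totalDegree ≤ t)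
    (hv : ∀ k ∈ K, ∀ P ∈ Gr (Fin d) k, evM p P = 0) :
    ∃ u : MvPolynomial (Fin d × Fin d) ℝ, (u = 0 ∨ u.totalDegree + K.card ≤ t) ∧
      ∀ P ∈ Gr (Fin d) j, evM p P = evM u P := by
  classical
  have hne : ∀ k ∈ K, k ≠ j := fun k hk h => hjK (h ▸ hk)
  rcases le_total (2 * j) d with h | h
  · refine key_small h K (fun k hk => ?_) p hp hv
    have h1 := hK k hk
    have h2 := hne k hk
    omega
  · have hflip : ∀ q : MvPolynomial (Fin d × Fin d) ℝ, ∃ q' : MvPolynomial (Fin d × Fin d) ℝ,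
        q'.totalDegree ≤ q.totalDegree ∧ ∀ P, evM q' P = evM q (1 - P) := by
      intro q
      refine ⟨bind₁ (fun ij => C ((1 : Matrix (Fin d) (Fin d) ℝ) ij.1 ij.2) - X ij) q,
        totalDegree_bind_le _ (fun ij => (totalDegree_sub _ _).trans (by simp)) q, fun P => ?_⟩
      unfold evM
      rw [eval_bind]
      simp
    have hGr : ∀ k ≤ d, ∀ P ∈ Gr (Fin d) k, 1 - P ∈ Gr (Fin d) (d - k) := by
      rintro k hk P ⟨h1, h2, h3⟩
      refine ⟨?_, ?_, ?_⟩
      · unfold IsSymm at *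
        simp [h1]
      · rw [Matrix.mul_sub, Matrix.sub_mul, Matrix.sub_mul, h2]; simp
      · rw [trace_sub, h3]; simp [Nat.cast_sub hk]
    obtain ⟨p', hp', hpe⟩ := hflip p
    obtain ⟨u, hu, hue⟩ := key_small (j := d - j) (t := t) (by omega) (K.image fun k => d - k)
      (by
        intro k' hk'
        obtain ⟨k, hk, rfl⟩ := Finset.mem_image.1 hk'
        have h1 := hK k hk
        have h2 := hne k hk
        omega) p' (hp'.trans hp)
      (by
        intro k' hk' P hP
        obtain ⟨k, hk, rfl⟩ := Finset.mem_image.1 hk'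
        rw [hpe]
        refine hv k hk _ ?_
        have := hGr _ (by omega) P hP
        rwa [Nat.sub_sub_self (hK k hk).1] at this)
    rw [Finset.card_image_of_injOn (by
      intro a ha b hb hab
      have h1 := (hK a ha).1
      have h2 := (hK b hb).1
      simp only at hab
      omega)] at hu
    obtain ⟨u', hu', hue'⟩ := hflip u
    have hfin : ∀ P ∈ Gr (Fin d) j, evM p P = evM u' P := by
      intro P hP
      rw [hue', ← hue _ (hGr j hj P hP), hpe]
      simp
    rcases hu with rfl | hu
    · refine ⟨0, Or.inl rfl, fun P hP => ?_⟩
      rw [hfin P hP, hue']; simp [evM]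
    · exact ⟨u', Or.inr (by omega), hfin⟩

theorem main_poly (d r t : ℕ) (hr : 0 < r) (ht : 1 ≤ t)
    (k : Fin r → ℕ) (hinj : Function.Injective k) (hk : ∀ i, k i ≤ d)
    (hord : ∀ i j : Fin r, i ≤ j → min (k j) (d - k j) ≤ min (k i) (d - k i))
    (p : MvPolynomial (Fin d × Fin d) ℝ) (hp : p.totalDegree ≤ t)
    (h0 : ∀ P ∈ Gr (Fin d) (k ⟨0, hr⟩), evM p P = 0) (n : ℕ) (hn : n + 1 ≤ r) :
    ∃ g : MvPolynomial (Fin d × Fin d) ℝ, g.totalDegree ≤ t - 1 ∧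
      ∀ i : Fin r, i.val < n + 1 → ∀ P ∈ Gr (Fin d) (k i),
        evM p P = (trace P - k ⟨0, hr⟩) * evM g P := by
  classical
  induction n with
  | zero =>
    refine ⟨0, by simp, fun i hi P hP => ?_⟩
    have : i = ⟨0, hr⟩ := Fin.ext (by simpa using hi)
    subst this
    rw [h0 P hP]; simp [evM]
  | succ n ih =>
    obtain ⟨g, hg, hge⟩ := ih (by omega)
    let N : Fin r := ⟨n + 1, hn⟩
    let I : Finset (Fin r) := Finset.univ.filter fun i => i.val < n + 1
    have hI : I.card = n + 1 := by
      rw [Fin.card_filter_val_lt, min_eq_right (by omega)]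
    have hI0 : (⟨0, hr⟩ : Fin r) ∈ I := by simp [I]
    let T : ℕ → MvPolynomial (Fin d × Fin d) ℝ := fun c => (∑ i, X (i, i)) - C (c : ℝ)
    have hT : ∀ c, (T c).totalDegree ≤ 1 := by
      intro c
      refine (totalDegree_sub _ _).trans (max_le ?_ (by rw [totalDegree_C]; omega))
      exact totalDegree_finsetSum_le fun i _ => by simp
    have hTe : ∀ c P, evM (T c) P = trace P - c := by
      intro c P
      simp [T, evM, Matrix.trace]
    obtain ⟨u, hu, hue⟩ := key_claim (t := t) (hk N) (I.image k)
      (by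
        intro c hc
        obtain ⟨i, hi, rfl⟩ := Finset.mem_image.1 hc
        refine ⟨hk i, hord i N ?_⟩
        have := (Finset.mem_filter.1 hi).2
        exact Fin.le_def.2 (by simp only [N]; omega))
      (by
        intro hc
        obtain ⟨i, hi, h⟩ := Finset.mem_image.1 hc
        have := (Finset.mem_filter.1 hi).2
        rw [hinj h] at this
        simp [N] at this)
      (p - T (k ⟨0, hr⟩) * g)
      ((totalDegree_sub _ _).trans (max_le hp ((totalDegree_mul _ _).trans (by
        have := hT (k ⟨0, hr⟩)
        omega))))
      (by
        intro c hc P hP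
        obtain ⟨i, hi, rfl⟩ := Finset.mem_image.1 hc
        have h1 := hge i (Finset.mem_filter.1 hi).2 P hP
        have h2 := hTe (k ⟨0, hr⟩) P
        unfold evM at *
        rw [map_sub, map_mul, h1, h2, sub_self])
    rw [Finset.card_image_of_injective _ hinj, hI] at hu
    let Z : ℝ := ∏ i ∈ I, ((k N : ℝ) - k i)
    have hZ : Z ≠ 0 := by
      refine Finset.prod_ne_zero_iff.2 fun i hi h => ?_
      have h1 : (k N : ℝ) = k i := by linarith
      have h2 := hinj (Nat.cast_injective h1)
      have := (Finset.mem_filter.1 hi).2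
      rw [← h2] at this
      simp [N] at this
    refine ⟨g + C Z⁻¹ * (u * ∏ i ∈ I.erase ⟨0, hr⟩, T (k i)), ?_, ?_⟩
    · refine (totalDegree_add _ _).trans (max_le hg ((totalDegree_mul _ _).trans ?_))
      rw [totalDegree_C, zero_add]
      rcases hu with rfl | hu
      · simp
      · refine (totalDegree_mul _ _).trans ?_
        have h1 : (∏ i ∈ I.erase ⟨0, hr⟩, T (k i)).totalDegree ≤ n := by
          refine (totalDegree_finsetProd _ _).trans ?_
          refine (Finset.sum_le_card_nsmul _ _ 1 fun i _ => hT _).trans ?_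
          rw [Finset.card_erase_of_mem hI0, hI]; simp
        omega
    · intro i hi P hP
      have hev : evM (g + C Z⁻¹ * (u * ∏ i ∈ I.erase ⟨0, hr⟩, T (k i))) P =
          evM g P + Z⁻¹ * (evM u P * ∏ i ∈ I.erase ⟨0, hr⟩, (trace P - k i)) := by
        simp only [← hTe]
        simp [evM]
      rw [hev]
      have htr := hP.2.2
      by_cases hiN : i.val < n + 1
      · have h1 := hge i hiN P hP
        by_cases hi0 : i = ⟨0, hr⟩
        · rw [h1, htr, hi0]; simp
        · rw [h1, Finset.prod_eq_zero (i := i)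
            (Finset.mem_erase.2 ⟨hi0, Finset.mem_filter.2 ⟨Finset.mem_univ _, hiN⟩⟩)
            (by rw [htr, sub_self])]
          ring
      · have hiN' : i = N := Fin.ext (by simp only [N]; omega)
        subst hiN'
        have h1 := hue P hP
        have h2 : evM (p - T (k ⟨0, hr⟩) * g) P =
            evM p P - (trace P - k ⟨0, hr⟩) * evM g P := by
          rw [← hTe]; simp [evM]
        have h3 : ((k N : ℝ) - k ⟨0, hr⟩) * ∏ i ∈ I.erase ⟨0, hr⟩, ((k N : ℝ) - k i) = Z :=
          Finset.mul_prod_erase I (fun i => (k N : ℝ) - k i) hI0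
        rw [h2] at h1
        rw [htr] at *
        have h4 : evM p P = ((k N : ℝ) - k ⟨0, hr⟩) * evM g P + evM u P := by linarith
        rw [h4]
        have h5 : ((k N : ℝ) - k ⟨0, hr⟩) * (evM g P + Z⁻¹ * (evM u P *
            ∏ i ∈ I.erase ⟨0, hr⟩, ((k N : ℝ) - k i))) =
            ((k N : ℝ) - k ⟨0, hr⟩) * evM g P + (Z⁻¹ * (((k N : ℝ) - k ⟨0, hr⟩) *
              ∏ i ∈ I.erase ⟨0, hr⟩, ((k N : ℝ) - k i))) * evM u P := by ring
        rw [h5, h3, inv_mul_cancel₀ hZ, one_mul]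

/-- The null space of the restriction map
`Pol_t(G_{K,d}) → Pol_t(G_{k₁,d})` equals `(Tr(·) − k₁) · Pol_{t−1}(G_{K,d})`:
a function `f ∈ Pol_t(G_{K,d})` vanishes identically on `G_{k₁,d}` if and only if
`f(P) = (tr(P) − k₁) g(P)` on `G_{K,d}` for some `g ∈ Pol_{t−1}(G_{K,d})`. -/
theorem nullspace_restriction_eq (d r t : ℕ) (hd : 2 ≤ d) (hr : 0 < r) (ht : 1 ≤ t)
    (k : Fin r → ℕ) (hinj : Function.Injective k) (hk : ∀ i, 1 ≤ k i ∧ k i ≤ d - 1)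
    (hord : ∀ i j : Fin r, i ≤ j → min (k j) (d - k j) ≤ min (k i) (d - k i))
    (f : (⋃ i, Grass d (k i)) → ℝ) (hf : f ∈ PolOn t (⋃ i, Grass d (k i))) :
    (∀ (P : Matrix (Fin d) (Fin d) ℝ) (hP : P ∈ Grass d (k ⟨0, hr⟩)),
        f ⟨P, Set.mem_iUnion_of_mem ⟨0, hr⟩ hP⟩ = 0) ↔
      ∃ g ∈ PolOn (t - 1) (⋃ i, Grass d (k i)),
        ∀ P : (⋃ i, Grass d (k i)),
          f P = (Matrix.trace (P : Matrix (Fin d) (Fin d) ℝ) - (k ⟨0, hr⟩ : ℝ)) * g P := by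
  obtain ⟨p, hp, rfl⟩ := hf
  have hp' : p.totalDegree ≤ t := (mem_restrictTotalDegree _ _ _).1 hp
  constructor
  · intro h
    obtain ⟨n, rfl⟩ : ∃ n, r = n + 1 := ⟨r - 1, by omega⟩
    obtain ⟨g, hg, hge⟩ := main_poly d (n + 1) t hr ht k hinj
      (fun i => by have := (hk i).2; omega) hord p hp' (fun P hP => h P hP) n le_rfl
    refine ⟨evalOn _ g, ⟨g, (mem_restrictTotalDegree _ _ _).2 hg, rfl⟩, ?_⟩
    rintro ⟨P, hP⟩
    obtain ⟨i, hi⟩ := Set.mem_iUnion.1 hP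
    exact hge i i.2 P hi
  · rintro ⟨g, _, hg⟩ P hP
    rw [hg]
    have : Matrix.trace P = k ⟨0, hr⟩ := hP.2.2
    simp [this]
end

section
/- Let x_1, …, x_m ∈ ℝ^d with m ≥ 2, let 0 < ε < 1, and let k be an integer with d ≥ k ≥ 4 ln(m)/(ε²/2 − ε³/2). Then there exists an orthogonal projection P ∈ G_{k,d} (a symmetric d×d matrix with P² = P and tr(P) = k) such that for all i, j ∈ {1, …, m}: (1−ε) ‖x_i − x_j‖² ≤ (d/k) ‖P x_i − P x_j‖² ≤ (1+ε) ‖x_i − x_j‖². -/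
open Matrix

open MeasureTheory ProbabilityTheory

namespace JL

instance unitaryCompact (d : ℕ) : CompactSpace (Matrix.unitaryGroup (Fin d) ℝ) := by
  have h1 : IsClosed (Matrix.unitaryGroup (Fin d) ℝ : Set (Matrix (Fin d) (Fin d) ℝ)) :=
    isClosed_unitary
  have h2 : IsCompact (Set.pi Set.univ (fun _ : Fin d => Set.pi Set.univ
      (fun _ : Fin d => Set.Icc (-1 : ℝ) 1))) :=
    isCompact_univ_pi fun _ => isCompact_univ_pi fun _ => isCompact_Icc
  have h3 : IsCompact (Matrix.unitaryGroup (Fin d) ℝ : Set (Matrix (Fin d) (Fin d) ℝ)) := by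
    refine IsCompact.of_isClosed_subset h2 h1 ?_
    intro U hU i _ j _
    have := entry_norm_bound_of_unitary hU i j
    rw [Real.norm_eq_abs] at this
    exact abs_le.mp this
  exact isCompact_iff_compactSpace.mp h3

instance unitaryMeas (d : ℕ) : MeasurableSpace (Matrix.unitaryGroup (Fin d) ℝ) := borel _
instance unitaryBorel (d : ℕ) : BorelSpace (Matrix.unitaryGroup (Fin d) ℝ) := ⟨rfl⟩
instance unitarySC (d : ℕ) : SecondCountableTopology (Matrix.unitaryGroup (Fin d) ℝ) := by
  have : SecondCountableTopology (Matrix (Fin d) (Fin d) ℝ) :=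
    inferInstanceAs (SecondCountableTopology (Fin d → Fin d → ℝ))
  exact TopologicalSpace.Subtype.secondCountableTopology _

noncomputable def mu (d : ℕ) : Measure (Matrix.unitaryGroup (Fin d) ℝ) :=
  Measure.haarMeasure ⊤

instance (d : ℕ) : IsProbabilityMeasure (mu d) := by
  constructor
  have := Measure.haarMeasure_self (K₀ := (⊤ : TopologicalSpace.PositiveCompacts (Matrix.unitaryGroup (Fin d) ℝ)))
  simpa [mu] using this

instance (d : ℕ) : (mu d).IsMulLeftInvariant := by
  unfold mu; infer_instance

noncomputable def gam (d : ℕ) : Measure (Fin d → ℝ) := Measure.pi fun _ => gaussianReal 0 1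

instance (d : ℕ) : IsProbabilityMeasure (gam d) := by
  unfold gam; infer_instance

/-- Householder reflection -/
lemma exists_unitary {d : ℕ} (v w : Fin d → ℝ) (h : v ⬝ᵥ v = w ⬝ᵥ w) :
    ∃ R : Matrix.unitaryGroup (Fin d) ℝ, R.1ᵀ *ᵥ v = w := by
  by_cases hu : v - w = 0
  · refine ⟨1, ?_⟩
    simp [sub_eq_zero.mp hu]
  set u := v - w with hudef
  have hs : u ⬝ᵥ u ≠ 0 := by simpa [dotProduct_self_eq_zero] using hu
  have hs2 : u ⬝ᵥ u = 2 * (u ⬝ᵥ v) := by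
    simp only [hudef, sub_dotProduct, dotProduct_sub, h, dotProduct_comm w v]; ring
  have hT : (1 - (2 / (u ⬝ᵥ u)) • vecMulVec u u)ᵀ = 1 - (2 / (u ⬝ᵥ u)) • vecMulVec u u := by
    simp [transpose_vecMulVec]
  refine ⟨⟨1 - (2 / (u ⬝ᵥ u)) • vecMulVec u u, ?_⟩, ?_⟩
  · rw [mem_unitaryGroup_iff, star_eq_conjTranspose, conjTranspose_eq_transpose_of_trivial, hT]
    simp only [sub_mul, mul_sub, mul_one, one_mul, smul_mul_smul_comm, vecMulVec_mul_vecMulVec,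
      vecMulVec_smul, smul_smul]
    have : 2 / (u ⬝ᵥ u) * (2 / (u ⬝ᵥ u)) * (u ⬝ᵥ u) = 2 / (u ⬝ᵥ u) + 2 / (u ⬝ᵥ u) := by
      field_simp; ring
    rw [this, add_smul]; abel
  · show (1 - (2 / (u ⬝ᵥ u)) • vecMulVec u u)ᵀ *ᵥ v = w
    rw [hT, sub_mulVec, one_mulVec, smul_mulVec, vecMulVec_mulVec]
    have : (2 / (u ⬝ᵥ u)) * (u ⬝ᵥ v) = 1 := by
      rw [hs2] at hs ⊢
      have h3 : u ⬝ᵥ v ≠ 0 := fun h => hs (by rw [h, mul_zero])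
      rw [div_mul_eq_mul_div, div_self hs]
    simp only [op_smul_eq_smul, smul_smul, this, one_smul]
    simp [hudef]

lemma gam_rot {d : ℕ} (Q : Matrix.unitaryGroup (Fin d) ℝ) :
    MeasurePreserving (fun g => Q.1ᵀ *ᵥ g) (gam d) (gam d) := by
  have hm : Measurable (fun g : Fin d → ℝ => Q.1ᵀ *ᵥ g) := by
    apply Continuous.measurable; fun_prop
  refine ⟨hm, ?_⟩
  have hQ : Q.1 * Q.1ᵀ = 1 := by
    have := mem_unitaryGroup_iff.mp Q.2
    rwa [star_eq_conjTranspose, conjTranspose_eq_transpose_of_trivial] at this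
  have hQ' : Q.1ᵀ * Q.1 = 1 := mul_eq_one_comm.mp hQ
  let L : EuclideanSpace ℝ (Fin d) ≃ₗ[ℝ] EuclideanSpace ℝ (Fin d) :=
    LinearEquiv.ofLinearMap (Matrix.toEuclideanLin Q.1ᵀ) (Matrix.toEuclideanLin Q.1)
      (by ext1 x; simp [Matrix.toLpLin_apply, mulVec_mulVec, hQ'])
      (by ext1 x; simp [Matrix.toLpLin_apply, mulVec_mulVec, hQ])
  have hL : ∀ x, L x = WithLp.toLp 2 (Q.1ᵀ *ᵥ x.ofLp) := fun x => rfl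
  let f : EuclideanSpace ℝ (Fin d) ≃ₗᵢ[ℝ] EuclideanSpace ℝ (Fin d) :=
    ⟨L, by
      intro x
      rw [← sq_eq_sq₀ (norm_nonneg _) (norm_nonneg _), EuclideanSpace.real_norm_sq_eq,
        EuclideanSpace.real_norm_sq_eq, hL]
      have : (Q.1ᵀ *ᵥ x.ofLp) ⬝ᵥ (Q.1ᵀ *ᵥ x.ofLp) = x.ofLp ⬝ᵥ x.ofLp := by
        rw [dotProduct_mulVec, vecMul_transpose, mulVec_mulVec, hQ, one_mulVec]
      simpa [dotProduct, pow_two] using this⟩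
  have h1 := stdGaussian_map f
  rw [← map_pi_eq_stdGaussian, Measure.map_map (by fun_prop) (by fun_prop)] at h1
  have h2 := congrArg (Measure.map (WithLp.ofLp)) h1
  rw [Measure.map_map (by fun_prop) (by fun_prop), Measure.map_map (by fun_prop) (by fun_prop)] at h2
  have e : (WithLp.ofLp ∘ WithLp.toLp 2 : (Fin d → ℝ) → (Fin d → ℝ)) = id := by ext; simp
  rw [e, Measure.map_id] at h2
  exact h2

def quad {d : ℕ} (c g : Fin d → ℝ) : ℝ := ∑ l, c l * g l ^ 2

lemma quad_cont {d : ℕ} (c : Fin d → ℝ) : Continuous (quad c) := by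
  unfold quad; fun_prop

noncomputable def F {d : ℕ} (c : Fin d → ℝ) (v : Fin d → ℝ) : ENNReal := mu d {Q | 0 ≤ quad c (Q.1ᵀ *ᵥ v)}

lemma F_rot {d : ℕ} (c v : Fin d → ℝ) (R : Matrix.unitaryGroup (Fin d) ℝ) :
    F c (R.1ᵀ *ᵥ v) = F c v := by
  unfold F
  rw [← measure_preimage_mul (mu d) R {Q | 0 ≤ quad c (Q.1ᵀ *ᵥ v)}]
  congr 1
  ext Q
  simp [transpose_mul, mulVec_mulVec]

lemma F_smul {d : ℕ} (c v : Fin d → ℝ) (a : ℝ) (ha : a ≠ 0) : F c (a • v) = F c v := by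
  unfold F
  congr 1
  ext Q
  have : quad c (Q.1ᵀ *ᵥ (a • v)) = a ^ 2 * quad c (Q.1ᵀ *ᵥ v) := by
    simp only [quad, mulVec_smul, Finset.mul_sum, Pi.smul_apply, smul_eq_mul]
    refine Finset.sum_congr rfl fun _ _ => by ring
  have ha2 : 0 < a ^ 2 := by positivity
  simp only [Set.mem_ofPred_eq, this, mul_nonneg_iff_of_pos_left ha2]

lemma F_const {d : ℕ} (c v w : Fin d → ℝ) (hv : v ≠ 0) (hw : w ≠ 0) : F c v = F c w := by
  have hv' : 0 < v ⬝ᵥ v := by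
    have : v ⬝ᵥ v ≠ 0 := by simpa [dotProduct_self_eq_zero] using hv
    have h0 : 0 ≤ v ⬝ᵥ v := Finset.sum_nonneg fun i _ => mul_self_nonneg _
    exact lt_of_le_of_ne h0 this.symm
  have hw' : 0 < w ⬝ᵥ w := by
    have : w ⬝ᵥ w ≠ 0 := by simpa [dotProduct_self_eq_zero] using hw
    have h0 : 0 ≤ w ⬝ᵥ w := Finset.sum_nonneg fun i _ => mul_self_nonneg _
    exact lt_of_le_of_ne h0 this.symm
  set a := Real.sqrt ((v ⬝ᵥ v) / (w ⬝ᵥ w)) with ha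
  have ha0 : 0 < a := Real.sqrt_pos.mpr (by positivity)
  have ha2 : a * a = (v ⬝ᵥ v) / (w ⬝ᵥ w) := Real.mul_self_sqrt (by positivity)
  obtain ⟨R, hR⟩ := exists_unitary v (a • w) (by
    rw [smul_dotProduct, dotProduct_smul, smul_smul, ha2, smul_eq_mul]; field_simp)
  rw [← F_smul c w a ha0.ne', ← hR, F_rot]

lemma gam_zero {d : ℕ} (hd : 0 < d) : ∀ᵐ g ∂(gam d), g ≠ 0 := by
  have : NullSingletonClass (gaussianReal 0 1) := nullSingletonClass_gaussianReal (by norm_num)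
  have h : gam d {0} = 0 := by
    have : ({0} : Set (Fin d → ℝ)) = Set.pi Set.univ (fun _ => {0}) := by
      ext g; simp [funext_iff]
    rw [this, gam, Measure.pi_pi]
    exact Finset.prod_eq_zero (Finset.mem_univ ⟨0, hd⟩) (measure_singleton 0)
  rw [ae_iff]; simpa using h

lemma F_eq {d : ℕ} (hd : 0 < d) (c v : Fin d → ℝ) (hv : v ≠ 0) :
    F c v = gam d {g | 0 ≤ quad c g} := by
  have hS : MeasurableSet {g : Fin d → ℝ | 0 ≤ quad c g} :=
    (isClosed_le continuous_const (quad_cont c)).measurableSet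
  have hT : MeasurableSet {p : (Fin d → ℝ) × Matrix.unitaryGroup (Fin d) ℝ |
      0 ≤ quad c (p.2.1ᵀ *ᵥ p.1)} := by
    refine (isClosed_le continuous_const ((quad_cont c).comp ?_)).measurableSet
    fun_prop
  calc F c v = ∫⁻ g, F c v ∂(gam d) := by simp
    _ = ∫⁻ g, F c g ∂(gam d) := by
        apply lintegral_congr_ae
        filter_upwards [gam_zero hd] with g hg using F_const c v g hv hg
    _ = ((gam d).prod (mu d)) {p | 0 ≤ quad c (p.2.1ᵀ *ᵥ p.1)} := by
        rw [Measure.prod_apply hT]; rfl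
    _ = ∫⁻ Q, gam d {g | 0 ≤ quad c (Q.1ᵀ *ᵥ g)} ∂(mu d) := by
        rw [Measure.prod_apply_symm hT]; rfl
    _ = ∫⁻ Q, gam d {g | 0 ≤ quad c g} ∂(mu d) := by
        congr 1; ext Q
        exact (gam_rot Q).measure_preimage hS.nullMeasurableSet
    _ = _ := by simp

lemma gauss_int (c : ℝ) (hc : 2 * c < 1) :
    Integrable (fun x => Real.exp (c * x ^ 2)) (gaussianReal 0 1) ∧
    ∫ x, Real.exp (c * x ^ 2) ∂(gaussianReal 0 1) = (Real.sqrt (1 - 2 * c))⁻¹ := by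
  have hpdf : ∀ x : ℝ, gaussianPDFReal 0 1 x * Real.exp (c * x ^ 2)
      = (Real.sqrt (2 * Real.pi))⁻¹ * Real.exp (-((1 - 2 * c) / 2) * x ^ 2) := by
    intro x
    simp only [gaussianPDFReal, NNReal.coe_one, mul_one, sub_zero]
    rw [mul_assoc, ← Real.exp_add]
    congr 2; ring
  have hb : 0 < (1 - 2 * c) / 2 := by linarith
  constructor
  · rw [gaussianReal_of_var_ne_zero _ (by norm_num)]
    rw [integrable_withDensity_iff_integrable_smul₀' (by fun_prop)
      (by simp [gaussianPDF])]
    simp only [gaussianPDF, ENNReal.toReal_ofReal (gaussianPDFReal_nonneg _ _ _), smul_eq_mul, hpdf]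
    exact (integrable_exp_neg_mul_sq hb).const_mul _
  · rw [integral_gaussianReal_eq_integral_smul (by norm_num)]
    simp only [smul_eq_mul, hpdf]
    rw [integral_const_mul, integral_gaussian, ← Real.sqrt_inv, ← Real.sqrt_inv, ← Real.sqrt_mul (by positivity)]
    congr 1
    have := Real.pi_pos
    have : 1 - 2 * c ≠ 0 := by linarith
    field_simp

lemma gam_bound {d : ℕ} (c : Fin d → ℝ) (hc : ∀ l, 2 * c l < 1) :
    gam d {g | 0 ≤ quad c g} ≤ ENNReal.ofReal (∏ l, (Real.sqrt (1 - 2 * c l))⁻¹) := by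
  have hi : Integrable (fun g : Fin d → ℝ => ∏ l, Real.exp (c l * g l ^ 2)) (gam d) :=
    Integrable.fintype_prod (f := fun l x => Real.exp (c l * x ^ 2)) fun l => (gauss_int _ (hc l)).1
  have he : ∫ g, ∏ l, Real.exp (c l * g l ^ 2) ∂(gam d) = ∏ l, (Real.sqrt (1 - 2 * c l))⁻¹ := by
    unfold gam
    rw [integral_fintype_prod_eq_prod (f := fun l x => Real.exp (c l * x ^ 2))]
    exact Finset.prod_congr rfl fun l _ => (gauss_int _ (hc l)).2
  have hM := mul_meas_ge_le_integral_of_nonneg (μ := gam d)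
    (f := fun g : Fin d → ℝ => ∏ l, Real.exp (c l * g l ^ 2))
    (Filter.Eventually.of_forall fun g => by positivity) hi 1
  rw [he, one_mul] at hM
  rw [← ofReal_measureReal]
  apply ENNReal.ofReal_le_ofReal
  convert hM using 4 with g
  rw [← Real.exp_sum, Real.one_le_exp_iff]; rfl


/-- indicator of the first `k` coordinates -/
def ind {d : ℕ} (k : ℕ) (l : Fin d) : ℝ := if l.1 < k then 1 else 0

lemma sum_ite {k d : ℕ} (hkd : k ≤ d) (a b : ℝ) :
    ∑ l : Fin d, (if l.1 < k then a else b) = k * a + (d - k) * b := by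
  obtain ⟨r, rfl⟩ := Nat.exists_eq_add_of_le hkd
  rw [Fin.sum_univ_add]
  simp

lemma tail {k d : ℕ} (hk : 0 < k) (hkd : k < d) (β : ℝ) (hβ : 0 < β) (hβd : k * β < d)
    (v : Fin d → ℝ) (hv : v ≠ 0) :
    mu d {Q | 0 ≤ (1 - β) * (k * β * (∑ l, (Q.1ᵀ *ᵥ v) l ^ 2) -
        d * ∑ l, ind k l * (Q.1ᵀ *ᵥ v) l ^ 2)} ≤
      ENNReal.ofReal (Real.exp (k / 2 * (1 - β + Real.log β))) := by
  have hkd' : (k : ℝ) < d := by exact_mod_cast hkd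
  have hD : 0 < (d : ℝ) - k * β := by linarith
  have hD' : 0 < (d : ℝ) - k := by linarith
  set s : ℝ := (2 * β * (d - k * β))⁻¹ with hs
  have hs0 : 0 < s := by positivity
  have hDne : (d : ℝ) - k * β ≠ 0 := hD.ne'
  let c : Fin d → ℝ := fun l => s * ((1 - β) * (k * β - d * ind k l))
  have hc1 : ∀ l, 1 - 2 * c l = if l.1 < k then β⁻¹ else (d - k) / (d - k * β) := by
    intro l
    simp only [c, ind, hs]
    generalize hE : (d : ℝ) - k * β = E at hDne
    have hdE : (d : ℝ) = E + k * β := by linarith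
    rw [hdE]
    split_ifs
    · field_simp; ring
    · field_simp; ring
  have hpos : ∀ l, 0 < 1 - 2 * c l := by
    intro l; rw [hc1]; split_ifs <;> positivity
  have hset : {Q : Matrix.unitaryGroup (Fin d) ℝ | 0 ≤ (1 - β) * (k * β * (∑ l, (Q.1ᵀ *ᵥ v) l ^ 2) -
        d * ∑ l, ind k l * (Q.1ᵀ *ᵥ v) l ^ 2)} = {Q | 0 ≤ quad c (Q.1ᵀ *ᵥ v)} := by
    ext Q
    have : quad c (Q.1ᵀ *ᵥ v) = s * ((1 - β) * (k * β * (∑ l, (Q.1ᵀ *ᵥ v) l ^ 2) -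
        d * ∑ l, ind k l * (Q.1ᵀ *ᵥ v) l ^ 2)) := by
      simp only [quad, c, Finset.mul_sum, ← Finset.sum_sub_distrib]
      exact Finset.sum_congr rfl fun l _ => by ring
    simp only [Set.mem_ofPred_eq, this, mul_nonneg_iff_of_pos_left hs0]
  rw [hset]
  change F c v ≤ _
  rw [F_eq (by omega) c v hv]
  refine (gam_bound c fun l => by linarith [hpos l]).trans (ENNReal.ofReal_le_ofReal ?_)
  have hfac : ∀ l, (Real.sqrt (1 - 2 * c l))⁻¹ ≤
      Real.exp (if l.1 < k then Real.log β / 2 else k * (1 - β) / (2 * (d - k))) := by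
    intro l
    have h1 : (Real.sqrt (1 - 2 * c l))⁻¹ = Real.exp (Real.log (1 - 2 * c l)⁻¹ / 2) := by
      rw [← Real.sqrt_inv, Real.exp_half, Real.exp_log (inv_pos.mpr (hpos l))]
    rw [h1, Real.exp_le_exp, hc1]
    split_ifs
    · simp
    · have h2 := Real.log_le_sub_one_of_pos (x := (((d : ℝ) - k) / (d - k * β))⁻¹) (by positivity)
      have h3 : (((d : ℝ) - k) / (d - k * β))⁻¹ - 1 = 2 * (k * (1 - β) / (2 * (d - k))) := by
        field_simp; ring
      linarith
  calc ∏ l, (Real.sqrt (1 - 2 * c l))⁻¹ ≤ ∏ l : Fin d,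
        Real.exp (if l.1 < k then Real.log β / 2 else k * (1 - β) / (2 * (d - k))) :=
        Finset.prod_le_prod (fun l _ => by positivity) fun l _ => hfac l
    _ = Real.exp (k / 2 * (1 - β + Real.log β)) := by
        rw [← Real.exp_sum, sum_ite hkd.le]
        congr 1
        field_simp; ring

lemma log_one_sub_le {ε : ℝ} (h0 : 0 < ε) (h1 : ε < 1) :
    Real.log (1 - ε) ≤ -ε - ε ^ 2 / 2 := by
  have h := Real.hasSum_pow_div_log_of_abs_lt_one (x := ε) (by rw [abs_of_pos h0]; exact h1)
  have := sum_le_hasSum (Finset.range 2) (fun i _ => by positivity) h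
  norm_num [Finset.sum_range_succ] at this
  linarith

lemma log_one_add_le {ε : ℝ} (h0 : 0 < ε) :
    Real.log (1 + ε) ≤ ε - ε ^ 2 / 2 + ε ^ 3 / 2 := by
  have hd : ∀ x ∈ Set.Ici (0 : ℝ), HasDerivAt (fun x => x - x ^ 2 / 2 + x ^ 3 / 3 - Real.log (1 + x))
      (1 - x + x ^ 2 - 1 / (1 + x)) x := by
    intro x hx
    have hx' : 0 ≤ x := hx
    have e := ((((hasDerivAt_id x).sub (((hasDerivAt_id x).pow 2).div_const 2)).add
      (((hasDerivAt_id x).pow 3).div_const 3)).sub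
      (((hasDerivAt_id x).const_add 1).log (by simp; positivity)))
    convert! e using 1
    simp
  have hm : MonotoneOn (fun x => x - x ^ 2 / 2 + x ^ 3 / 3 - Real.log (1 + x)) (Set.Ici (0 : ℝ)) := by
    refine monotoneOn_of_deriv_nonneg (convex_Ici 0)
      (fun x hx => (hd x hx).continuousAt.continuousWithinAt)
      (fun x hx => (hd x (interior_subset hx)).differentiableAt.differentiableWithinAt) ?_
    intro x hx
    have hx' : 0 ≤ x := interior_subset hx
    rw [(hd x (interior_subset hx)).deriv]
    have : 1 - x + x ^ 2 - 1 / (1 + x) = x ^ 3 / (1 + x) := by field_simp; ring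
    rw [this]; positivity
  have := hm (Set.mem_Ici.mpr le_rfl) (Set.mem_Ici.mpr h0.le) h0.le
  simp at this
  have : 0 < ε ^ 3 := by positivity
  linarith

lemma norm_inv {d : ℕ} (Q : Matrix.unitaryGroup (Fin d) ℝ) (v : Fin d → ℝ) :
    ∑ l, (Q.1ᵀ *ᵥ v) l ^ 2 = ∑ l, v l ^ 2 := by
  have hQ : Q.1 * Q.1ᵀ = 1 := by
    have := mem_unitaryGroup_iff.mp Q.2
    rwa [star_eq_conjTranspose, conjTranspose_eq_transpose_of_trivial] at this
  have : (Q.1ᵀ *ᵥ v) ⬝ᵥ (Q.1ᵀ *ᵥ v) = v ⬝ᵥ v := by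
    rw [dotProduct_mulVec, vecMul_transpose, mulVec_mulVec, hQ, one_mulVec]
  simpa [dotProduct, pow_two] using this

def Bad {d : ℕ} (k : ℕ) (ε : ℝ) (v : Fin d → ℝ) : Set (Matrix.unitaryGroup (Fin d) ℝ) :=
  {Q | ¬ (k * (1 - ε) * (∑ l, v l ^ 2) ≤ d * ∑ l, ind k l * (Q.1ᵀ *ᵥ v) l ^ 2 ∧
    d * ∑ l, ind k l * (Q.1ᵀ *ᵥ v) l ^ 2 ≤ k * (1 + ε) * (∑ l, v l ^ 2))}

lemma bad_bound {k d m : ℕ} (hm : 2 ≤ m) (hk : 0 < k) (hkd : k < d) {ε : ℝ} (h0 : 0 < ε) (h1 : ε < 1)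
    (hkm : 2 * Real.log m ≤ k / 2 * (ε ^ 2 / 2 - ε ^ 3 / 2)) (v : Fin d → ℝ) :
    (mu d).real (Bad k ε v) ≤ 2 / m ^ 2 := by
  have hm0 : (0 : ℝ) < m := by positivity
  have hk0 : (0 : ℝ) < k := by positivity
  by_cases hv : v = 0
  · have : Bad k ε v = ∅ := by
      ext Q; simp [Bad, hv]
    rw [this]; simp; positivity
  have hexp : Real.exp (-(2 * Real.log m)) = 1 / m ^ 2 := by
    rw [Real.exp_neg, two_mul, Real.exp_add, Real.exp_log hm0, ← pow_two, one_div]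
  have hlo : Real.exp (k / 2 * (1 - (1 - ε) + Real.log (1 - ε))) ≤ 1 / m ^ 2 := by
    rw [← hexp, Real.exp_le_exp]
    have := log_one_sub_le h0 h1
    have h3 : 0 < ε ^ 3 := by positivity
    have : (k : ℝ) / 2 * (1 - (1 - ε) + Real.log (1 - ε)) ≤ k / 2 * (-(ε ^ 2 / 2 - ε ^ 3 / 2)) :=
      mul_le_mul_of_nonneg_left (by linarith) (by positivity)
    linarith
  have hup : Real.exp (k / 2 * (1 - (1 + ε) + Real.log (1 + ε))) ≤ 1 / m ^ 2 := by
    rw [← hexp, Real.exp_le_exp]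
    have := log_one_add_le h0
    have : (k : ℝ) / 2 * (1 - (1 + ε) + Real.log (1 + ε)) ≤ k / 2 * (-(ε ^ 2 / 2 - ε ^ 3 / 2)) :=
      mul_le_mul_of_nonneg_left (by linarith) (by positivity)
    linarith
  have hkd' : (k : ℝ) < d := by exact_mod_cast hkd
  let B : ℝ → Set (Matrix.unitaryGroup (Fin d) ℝ) := fun β =>
    {Q | 0 ≤ (1 - β) * (k * β * (∑ l, (Q.1ᵀ *ᵥ v) l ^ 2) -
        d * ∑ l, ind k l * (Q.1ᵀ *ᵥ v) l ^ 2)}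
  have hB : ∀ β : ℝ, 0 < β → k * β < d → Real.exp (k / 2 * (1 - β + Real.log β)) ≤ 1 / m ^ 2 →
      (mu d).real (B β) ≤ 1 / m ^ 2 := by
    intro β hβ hβd hb
    refine le_trans ?_ hb
    exact ENNReal.toReal_le_of_le_ofReal (Real.exp_pos _).le (tail hk hkd β hβ hβd v hv)
  have hB1 := hB (1 - ε) (by linarith) (by nlinarith) hlo
  have hmem1 : ∀ Q : Matrix.unitaryGroup (Fin d) ℝ, Q ∉ B (1 - ε) →
      k * (1 - ε) * (∑ l, v l ^ 2) ≤ d * ∑ l, ind k l * (Q.1ᵀ *ᵥ v) l ^ 2 := by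
    intro Q hQ
    by_contra! hcon
    apply hQ
    simp only [B, Set.mem_ofPred_eq]
    rw [norm_inv]
    exact mul_nonneg (by linarith) (by linarith)
  by_cases hc : k * (1 + ε) < d
  · have hB2 := hB (1 + ε) (by linarith) hc hup
    have hsub : Bad k ε v ⊆ B (1 - ε) ∪ B (1 + ε) := by
      intro Q hQ
      by_contra hcon
      rw [Set.mem_union, not_or] at hcon
      refine hQ ⟨hmem1 Q hcon.1, ?_⟩
      by_contra! hcon2
      apply hcon.2
      simp only [B, Set.mem_ofPred_eq]
      rw [norm_inv]
      exact mul_nonneg_of_nonpos_of_nonpos (by linarith) (by linarith)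
    calc (mu d).real (Bad k ε v) ≤ (mu d).real (B (1 - ε) ∪ B (1 + ε)) := measureReal_mono hsub
      _ ≤ _ := measureReal_union_le _ _
      _ ≤ 1 / m ^ 2 + 1 / m ^ 2 := add_le_add hB1 hB2
      _ = _ := by ring
  · have hsub : Bad k ε v ⊆ B (1 - ε) := by
      intro Q hQ
      by_contra hcon
      refine hQ ⟨hmem1 Q hcon, ?_⟩
      have h2 : ∑ l, ind k l * (Q.1ᵀ *ᵥ v) l ^ 2 ≤ ∑ l, v l ^ 2 := by
        rw [← norm_inv Q v]
        refine Finset.sum_le_sum fun l _ => ?_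
        unfold ind; split_ifs
        · simp
        · simp; positivity
      have h3 : 0 ≤ ∑ l, v l ^ 2 := by positivity
      calc d * ∑ l, ind k l * (Q.1ᵀ *ᵥ v) l ^ 2 ≤ d * ∑ l, v l ^ 2 := by gcongr
        _ ≤ _ := mul_le_mul_of_nonneg_right (not_lt.mp hc) h3
    calc (mu d).real (Bad k ε v) ≤ (mu d).real (B (1 - ε)) := measureReal_mono hsub
      _ ≤ 1 / m ^ 2 := hB1
      _ ≤ _ := by gcongr; norm_num

lemma exists_good {k d m : ℕ} (hm : 2 ≤ m) (hk : 0 < k) (hkd : k < d) {ε : ℝ} (h0 : 0 < ε) (h1 : ε < 1)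
    (hkm : 2 * Real.log m ≤ k / 2 * (ε ^ 2 / 2 - ε ^ 3 / 2)) (x : Fin m → Fin d → ℝ) :
    ∃ Q : Matrix.unitaryGroup (Fin d) ℝ, ∀ i j, j < i → Q ∉ Bad k ε (x i - x j) := by
  have hm0 : (0 : ℝ) < m := by positivity
  let S : Finset (Σ _ : Fin m, Fin m) := Finset.univ.sigma fun i => Finset.Iio i
  have hcard : (S.card : ℝ) * 2 = m * (m - 1) := by
    have h : S.card * 2 = m * (m - 1) := by
      simp only [S, Finset.card_sigma, Fin.card_Iio]
      rw [Fin.sum_univ_eq_sum_range (fun i => i), Finset.sum_range_id_mul_two]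
    have := congrArg (Nat.cast (R := ℝ)) h
    push_cast [Nat.cast_sub (show 1 ≤ m by omega)] at this
    exact this
  have hU : (mu d).real (⋃ p ∈ S, Bad k ε (x p.1 - x p.2)) < 1 := by
    calc _ ≤ ∑ p ∈ S, (mu d).real (Bad k ε (x p.1 - x p.2)) := measureReal_biUnion_finset_le _ _
      _ ≤ ∑ p ∈ S, (2 / m ^ 2 : ℝ) := Finset.sum_le_sum fun p _ => bad_bound hm hk hkd h0 h1 hkm _
      _ = (m - 1) / m := by
        rw [Finset.sum_const, nsmul_eq_mul, mul_div_assoc', hcard]; field_simp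
      _ < 1 := by rw [div_lt_one hm0]; linarith
  by_contra! hcon
  have : (⋃ p ∈ S, Bad k ε (x p.1 - x p.2)) = Set.univ := by
    rw [Set.eq_univ_iff_forall]
    intro Q
    obtain ⟨i, j, hij, hQ⟩ := hcon Q
    simp only [Set.mem_iUnion]
    exact ⟨⟨i, j⟩, by simp [S, hij], hQ⟩
  rw [this] at hU
  simp at hU

end JL

theorem johnson_lindenstrauss (d m k : ℕ) (hm : 2 ≤ m) (x : Fin m → Fin d → ℝ)
    (ε : ℝ) (hε0 : 0 < ε) (hε1 : ε < 1) (hkd : k ≤ d)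
    (hk : (k : ℝ) ≥ 4 * Real.log m / (ε ^ 2 / 2 - ε ^ 3 / 2)) :
    ∃ P : Matrix (Fin d) (Fin d) ℝ, P.IsSymm ∧ P * P = P ∧ P.trace = k ∧
      ∀ i j : Fin m,
        (1 - ε) * (∑ l, (x i l - x j l) ^ 2) ≤
            ((d : ℝ) / k) * (∑ l, (P.mulVec (x i) l - P.mulVec (x j) l) ^ 2) ∧
          ((d : ℝ) / k) * (∑ l, (P.mulVec (x i) l - P.mulVec (x j) l) ^ 2) ≤
            (1 + ε) * (∑ l, (x i l - x j l) ^ 2) := by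
  have hden : 0 < ε ^ 2 / 2 - ε ^ 3 / 2 := by
    have : ε ^ 2 / 2 - ε ^ 3 / 2 = ε ^ 2 * (1 - ε) / 2 := by ring
    rw [this]
    have : 0 < 1 - ε := by linarith
    positivity
  have hlog : 0 < Real.log m := Real.log_pos (by exact_mod_cast (by omega : 1 < m))
  have hk0 : (0 : ℝ) < k := lt_of_lt_of_le (by positivity) hk
  have hk0' : 0 < k := by exact_mod_cast hk0
  have hkm : 2 * Real.log m ≤ k / 2 * (ε ^ 2 / 2 - ε ^ 3 / 2) := by
    have := (div_le_iff₀ hden).mp hk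
    linarith
  rcases hkd.eq_or_lt with rfl | hlt
  · refine ⟨1, isSymm_one, by simp, by simp, fun i j => ?_⟩
    rw [div_self hk0.ne']
    simp only [one_mulVec, one_mul]
    have : 0 ≤ ∑ l, (x i l - x j l) ^ 2 := by positivity
    constructor <;> nlinarith
  obtain ⟨Q, hQ⟩ := JL.exists_good hm hk0' hlt hε0 hε1 hkm x
  have hQ1 : Q.1 * Q.1ᵀ = 1 := by
    have := mem_unitaryGroup_iff.mp Q.2
    rwa [star_eq_conjTranspose, conjTranspose_eq_transpose_of_trivial] at this
  have hQ2 : Q.1ᵀ * Q.1 = 1 := mul_eq_one_comm.mp hQ1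
  let D : Matrix (Fin d) (Fin d) ℝ := diagonal (JL.ind k)
  have hind : ∀ l : Fin d, JL.ind k l * JL.ind k l = JL.ind k l := by
    intro l; unfold JL.ind; split_ifs <;> simp
  have hDD : D * D = D := by
    simp [D, diagonal_mul_diagonal, hind]
  have hsymm : (Q.1 * D * Q.1ᵀ)ᵀ = Q.1 * D * Q.1ᵀ := by
    simp [transpose_mul, D, mul_assoc]
  have hPP : (Q.1 * D * Q.1ᵀ) * (Q.1 * D * Q.1ᵀ) = Q.1 * D * Q.1ᵀ := by
    calc _ = Q.1 * D * (Q.1ᵀ * Q.1) * D * Q.1ᵀ := by simp only [mul_assoc]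
      _ = Q.1 * (D * D) * Q.1ᵀ := by rw [hQ2, mul_one]; simp only [mul_assoc]
      _ = _ := by rw [hDD]
  refine ⟨Q.1 * D * Q.1ᵀ, hsymm, hPP, ?_, ?_⟩
  · rw [trace_mul_comm, ← mul_assoc, hQ2, one_mul, trace_diagonal]
    simpa [JL.ind] using JL.sum_ite hkd 1 0
  have hnorm : ∀ v : Fin d → ℝ, ∑ l, ((Q.1 * D * Q.1ᵀ) *ᵥ v) l ^ 2 =
      ∑ l, JL.ind k l * (Q.1ᵀ *ᵥ v) l ^ 2 := by
    intro v
    have : ((Q.1 * D * Q.1ᵀ) *ᵥ v) ⬝ᵥ ((Q.1 * D * Q.1ᵀ) *ᵥ v)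
        = (Q.1ᵀ *ᵥ v) ⬝ᵥ (D *ᵥ (Q.1ᵀ *ᵥ v)) := by
      rw [dotProduct_mulVec, ← mulVec_transpose, hsymm, mulVec_mulVec, hPP, ← mulVec_mulVec,
        ← mulVec_mulVec, dotProduct_comm, dotProduct_mulVec, ← mulVec_transpose]
    simp only [dotProduct, ← pow_two] at this
    rw [this]
    refine Finset.sum_congr rfl fun l _ => ?_
    simp only [D, mulVec_diagonal]; ring
  have key : ∀ i j : Fin m, j < i →
        (1 - ε) * (∑ l, (x i l - x j l) ^ 2) ≤
            ((d : ℝ) / k) * (∑ l, ((Q.1 * D * Q.1ᵀ).mulVec (x i) l - (Q.1 * D * Q.1ᵀ).mulVec (x j) l) ^ 2) ∧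
          ((d : ℝ) / k) * (∑ l, ((Q.1 * D * Q.1ᵀ).mulVec (x i) l - (Q.1 * D * Q.1ᵀ).mulVec (x j) l) ^ 2) ≤
            (1 + ε) * (∑ l, (x i l - x j l) ^ 2) := by
    intro i j hij
    have h := not_not.mp (hQ i j hij)
    rw [← hnorm] at h
    simp only [mulVec_sub, Pi.sub_apply] at h
    rw [div_mul_eq_mul_div, le_div_iff₀ hk0, div_le_iff₀ hk0]
    constructor
    · linarith [h.1]
    · linarith [h.2]
  intro i j
  rcases lt_trichotomy i j with h | h | h
  · have := key j i h
    simp only [sub_sq_comm (x j _), sub_sq_comm (mulVec _ (x j) _)] at this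
    exact this
  · subst h; simp
  · exact key i j h
end
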